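/- arXiv:2210.13121 — 3 statements merged into one kernel-verified Lean document; each statement's English description precedes it below -/
import Mathlib

section
/- Let X_1, X_2, … be i.i.d. real-valued random variables with common law P. Then for every α ∈ ℝ, the limit lim_{n→∞} −(1/n) log ℙ{(1/n)∑_{i=1}^n X_i ≥ α} exists in [0,+∞] and equals γ_+(α) := inf{ D(Q‖P) : Q a probability measure on ℝ whose mean E_Q[X] = ∫x dQ(x) is well-defined (the negative part of the identity is Q-integrable) and satisfies E_Q[X] ≥ α }. -/
open MeasureTheory Filter Topology
open scoped ENNReal NNReal Classical

/-- Relative entropy `D(Q‖P)`: `∫ log (dQ/dP) dQ` if `Q ≪ P` (and the integral is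
well-defined), `+∞` otherwise. -/
noncomputable def relEnt {X : Type*} [MeasurableSpace X] (Q P : Measure X) : ℝ≥0∞ :=
  if Q ≪ P ∧ Integrable (llr Q P) Q then ENNReal.ofReal (∫ x, llr Q P x ∂Q) else ⊤

open ProbabilityTheory

/-- A product of measures with density has the product of the densities as density. -/
lemma pi_withDensity_eq {X : Type*} [MeasurableSpace X] (P : Measure X) [IsProbabilityMeasure P]
    {f : X → ℝ≥0∞} (hf : Measurable f) [SigmaFinite (P.withDensity f)] (n : ℕ) :
    (Measure.pi fun _ : Fin n => P.withDensity f) =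
      (Measure.pi fun _ : Fin n => P).withDensity (fun x => ∏ i, f (x i)) := by
  refine Measure.pi_eq fun s hs => ?_
  rw [withDensity_apply _ (.univ_pi hs), ← lintegral_indicator (.univ_pi hs)]
  have hm (i : Fin n) : Measurable ((s i).indicator f) := hf.indicator (hs i)
  have hprod : ((Set.univ.pi s).indicator fun x : Fin n → X => ∏ i, f (x i)) =
      fun x => ∏ i, (s i).indicator f (x i) := by
    ext x
    by_cases hx : x ∈ Set.univ.pi s
    · rw [Set.indicator_of_mem hx]
      exact Finset.prod_congr rfl fun i _ => (Set.indicator_of_mem (hx i trivial) f).symm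
    · rw [Set.indicator_of_notMem hx]
      obtain ⟨i, hi⟩ : ∃ i, x i ∉ s i := by simpa [Set.mem_pi] using hx
      exact (Finset.prod_eq_zero (Finset.mem_univ i) (Set.indicator_of_notMem hi f)).symm
  have hind : iIndepFun (fun i (x : Fin n → X) => (s i).indicator f (x i))
      (Measure.pi fun _ : Fin n => P) := iIndepFun_pi fun i => (hm i).aemeasurable
  rw [hprod]
  have := lintegral_prod_eq_prod_lintegral_of_indepFun (μ := Measure.pi fun _ : Fin n => P)
    Finset.univ (fun i (x : Fin n → X) => (s i).indicator f (x i)) hind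
    (fun i => (hm i).comp (measurable_pi_apply i))
  refine this.trans (Finset.prod_congr rfl fun i _ => ?_)
  rw [withDensity_apply _ (hs i), ← lintegral_indicator (hs i)]
  exact (measurePreserving_eval (fun _ : Fin n => P) i).lintegral_comp (hm i)

/-- Change of measure on a product space: if `Q` has density at most `exp ℓ` with respect to `P`,
then `Qⁿ ≤ exp C * Pⁿ` on events on which `∑ ℓ (x i) ≤ C`. -/
lemma pi_le_exp_mul_pi {X : Type*} [MeasurableSpace X] (P Q : Measure X) [IsProbabilityMeasure P]
    [IsProbabilityMeasure Q] {ℓ : X → ℝ}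
    (hQP : Q ≤ P.withDensity fun x => ENNReal.ofReal (Real.exp (ℓ x))) {n : ℕ}
    {E : Set (Fin n → X)} (hE : MeasurableSet E) {C : ℝ} (hC : ∀ x ∈ E, ∑ i, ℓ (x i) ≤ C) :
    Measure.pi (fun _ : Fin n => Q) E ≤
      ENNReal.ofReal (Real.exp C) * Measure.pi (fun _ : Fin n => P) E := by
  have hac : Q ≪ P := (Measure.absolutelyContinuous_of_le hQP).trans
    (withDensity_absolutelyContinuous _ _)
  have hfg : Q.rnDeriv P ≤ᵐ[P] fun x => ENNReal.ofReal (Real.exp (ℓ x)) := by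
    refine ae_le_of_forall_setLIntegral_le_of_sigmaFinite (Measure.measurable_rnDeriv _ _) ?_
    intro s hs _
    refine (Measure.setLIntegral_rnDeriv_le s).trans ?_
    rw [← withDensity_apply _ hs]
    exact hQP s
  have hae : ∀ᵐ x ∂(Measure.pi fun _ : Fin n => P), ∀ i,
      Q.rnDeriv P (x i) ≤ ENNReal.ofReal (Real.exp (ℓ (x i))) :=
    ae_all_iff.2 fun i => (measurePreserving_eval (fun _ : Fin n => P) i).quasiMeasurePreserving.ae
      hfg
  have hQ : P.withDensity (Q.rnDeriv P) = Q := Measure.withDensity_rnDeriv_eq Q P hac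
  have : IsProbabilityMeasure (P.withDensity (Q.rnDeriv P)) := by rw [hQ]; infer_instance
  have hpi := pi_withDensity_eq P (Measure.measurable_rnDeriv Q P) n
  simp only [hQ] at hpi
  rw [hpi, withDensity_apply _ hE]
  calc ∫⁻ x in E, ∏ i, Q.rnDeriv P (x i) ∂(Measure.pi fun _ : Fin n => P)
      ≤ ∫⁻ _ in E, ENNReal.ofReal (Real.exp C) ∂(Measure.pi fun _ : Fin n => P) := by
        refine lintegral_mono_ae ?_
        filter_upwards [ae_restrict_of_ae hae, ae_restrict_mem hE] with x hx hxE
        calc ∏ i, Q.rnDeriv P (x i) ≤ ∏ i, ENNReal.ofReal (Real.exp (ℓ (x i))) :=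
              Finset.prod_le_prod' fun i _ => hx i
          _ = ENNReal.ofReal (Real.exp (∑ i, ℓ (x i))) := by
              rw [Real.exp_sum, ENNReal.ofReal_prod_of_nonneg fun i _ => (Real.exp_pos _).le]
          _ ≤ _ := ENNReal.ofReal_le_ofReal (Real.exp_le_exp.2 (hC x hxE))
    _ = _ := by simp

/-- The strong law of large numbers for the coordinates of an infinite product. -/
lemma ae_tendsto_average_infinitePi {X : Type*} [MeasurableSpace X] (Q : Measure X)
    [IsProbabilityMeasure Q] {Y : X → ℝ} (hY : Measurable Y) (hint : Integrable Y Q) :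
    ∀ᵐ ω ∂(Measure.infinitePi fun _ : ℕ => Q),
      Tendsto (fun n : ℕ => (∑ i ∈ Finset.range n, Y (ω i)) / n) atTop (𝓝 (∫ x, Y x ∂Q)) := by
  have hmp (i : ℕ) := measurePreserving_eval_infinitePi (fun _ : ℕ => Q) i
  have hind : iIndepFun (fun (i : ℕ) (ω : ℕ → X) => Y (ω i)) (Measure.infinitePi fun _ : ℕ => Q) :=
    iIndepFun_infinitePi (P := fun _ : ℕ => Q) (X := fun _ x => Y x) fun _ => hY
  have hid (i : ℕ) : IdentDistrib (fun ω : ℕ → X => ω i) (fun ω => ω 0)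
      (Measure.infinitePi fun _ : ℕ => Q) (Measure.infinitePi fun _ : ℕ => Q) :=
    ⟨(hmp i).measurable.aemeasurable, (hmp 0).measurable.aemeasurable,
      (hmp i).map_eq.trans (hmp 0).map_eq.symm⟩
  have h := strong_law_ae_real (μ := Measure.infinitePi fun _ : ℕ => Q)
    (fun (i : ℕ) (ω : ℕ → X) => Y (ω i)) ((hmp 0).integrable_comp_of_integrable hint)
    (fun i j hij => hind.indepFun hij) (fun i => (hid i).comp hY)
  have hmean : ∫ ω, Y (ω 0) ∂(Measure.infinitePi fun _ : ℕ => Q) = ∫ x, Y x ∂Q := by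
    have := integral_map (μ := Measure.infinitePi fun _ : ℕ => Q) (hmp 0).measurable.aemeasurable
      (f := Y) hY.aestronglyMeasurable
    rw [(hmp 0).map_eq] at this
    exact this.symm
  rwa [hmean] at h

lemma measurePreserving_fin_infinitePi {X : Type*} [MeasurableSpace X] (Q : Measure X)
    [IsProbabilityMeasure Q] (n : ℕ) :
    MeasurePreserving (fun (ω : ℕ → X) (i : Fin n) => ω i) (Measure.infinitePi fun _ : ℕ => Q)
      (Measure.pi fun _ : Fin n => Q) := by
  refine ⟨by fun_prop, ?_⟩
  have hind : iIndepFun (fun (i : ℕ) (ω : ℕ → X) => ω i) (Measure.infinitePi fun _ : ℕ => Q) :=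
    iIndepFun_infinitePi (P := fun _ : ℕ => Q) (X := fun _ x => x) fun _ => measurable_id
  have h := (hind.precomp (g := fun i : Fin n => (i : ℕ)) Fin.val_injective).map_fun_eq_pi_map
    (fun i => (measurable_pi_apply _).aemeasurable)
  refine h.trans ?_
  congr 1
  ext1 i
  exact (measurePreserving_eval_infinitePi (fun _ : ℕ => Q) i).map_eq

/-- Cramér's lower bound for a measure `Q` under which the sample means eventually exceed `α`. -/
lemma eventually_exp_le_of_ae_eventually (P Q : Measure ℝ) [IsProbabilityMeasure P]
    [IsProbabilityMeasure Q] {α c : ℝ} {ℓ : ℝ → ℝ} (hℓ : Measurable ℓ) (hint : Integrable ℓ Q)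
    (hQP : Q ≤ P.withDensity fun x => ENNReal.ofReal (Real.exp (ℓ x)))
    (hα : ∀ᵐ ω ∂(Measure.infinitePi fun _ : ℕ => Q),
      ∀ᶠ n : ℕ in atTop, α ≤ (∑ i ∈ Finset.range n, ω i) / n)
    (hc : ∫ x, ℓ x ∂Q < c) :
    ∀ᶠ n : ℕ in atTop, ENNReal.ofReal (Real.exp (-(n * c))) ≤
      (Measure.pi fun _ : Fin n => P) {x | α ≤ (∑ i, x i) / n} := by
  obtain ⟨d, hd, hdc⟩ := exists_between hc
  let E (n : ℕ) : Set (Fin n → ℝ) := {x | α ≤ (∑ i, x i) / n ∧ ∑ i, ℓ (x i) ≤ n * d}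
  have hE (n : ℕ) : MeasurableSet (E n) :=
    MeasurableSet.inter (s₁ := {x : Fin n → ℝ | α ≤ (∑ i, x i) / n})
      (s₂ := {x : Fin n → ℝ | ∑ i, ℓ (x i) ≤ n * d})
      (measurableSet_le (by fun_prop) (by fun_prop)) (measurableSet_le (by fun_prop) (by fun_prop))
  have hlim : Tendsto (fun n => (Measure.infinitePi fun _ : ℕ => Q)
      ((fun (ω : ℕ → ℝ) (i : Fin n) => ω i) ⁻¹' E n)) atTop
      (𝓝 ((Measure.infinitePi fun _ : ℕ => Q) Set.univ)) := by
    refine tendsto_measure_of_ae_tendsto_indicator atTop .univ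
      (fun n => (measurePreserving_fin_infinitePi Q n).measurable (hE n)) .univ
      (measure_ne_top _ _) (.of_forall fun _ => Set.subset_univ _) ?_
    filter_upwards [hα, ae_tendsto_average_infinitePi Q hℓ hint] with ω h1 h2
    filter_upwards [h1, h2.eventually_lt_const hd, eventually_gt_atTop 0] with n h3 h4 hn
    have hn' : (0 : ℝ) < n := by exact_mod_cast hn
    simp only [Set.mem_preimage, Set.mem_univ, iff_true, E, Set.mem_ofPred_eq]
    rw [Fin.sum_univ_eq_sum_range (fun i => ω i) n, Fin.sum_univ_eq_sum_range (fun i => ℓ (ω i)) n]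
    exact ⟨h3, by rw [div_lt_iff₀ hn'] at h4; linarith⟩
  rw [measure_univ] at hlim
  have hhalf : ∀ᶠ n : ℕ in atTop, Real.exp (-(n * (c - d))) < 1 / 2 := by
    have : Tendsto (fun n : ℕ => Real.exp (-(n * (c - d)))) atTop (𝓝 0) :=
      Real.tendsto_exp_neg_atTop_nhds_zero.comp
        (tendsto_natCast_atTop_atTop.atTop_mul_const (sub_pos.2 hdc))
    exact this.eventually_lt_const (by norm_num)
  have h2 : ENNReal.ofReal (1 / 2) < 1 := by
    rw [← ENNReal.ofReal_one]; exact (ENNReal.ofReal_lt_ofReal_iff one_pos).2 (by norm_num)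
  filter_upwards [hhalf, hlim.eventually_const_lt h2] with n hn1 hn2
  rw [(measurePreserving_fin_infinitePi Q n).measure_preimage (hE n).nullMeasurableSet] at hn2
  have h3 := pi_le_exp_mul_pi P Q hQP (hE n) (C := n * d) fun x hx => hx.2
  have h4 : ENNReal.ofReal (Real.exp (-(n * d))) * Measure.pi (fun _ : Fin n => Q) (E n) ≤
      Measure.pi (fun _ : Fin n => P) (E n) := by
    refine (mul_le_mul_right h3 _).trans ?_
    rw [← mul_assoc, ← ENNReal.ofReal_mul (Real.exp_pos _).le, ← Real.exp_add]
    simp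
  calc ENNReal.ofReal (Real.exp (-(n * c)))
      = ENNReal.ofReal (Real.exp (-(n * d))) * ENNReal.ofReal (Real.exp (-(n * (c - d)))) := by
        rw [← ENNReal.ofReal_mul (Real.exp_pos _).le, ← Real.exp_add]; ring_nf
    _ ≤ ENNReal.ofReal (Real.exp (-(n * d))) * Measure.pi (fun _ : Fin n => Q) (E n) := by
        gcongr
        exact (ENNReal.ofReal_le_ofReal hn1.le).trans hn2.le
    _ ≤ Measure.pi (fun _ : Fin n => P) (E n) := h4
    _ ≤ _ := measure_mono fun x hx => hx.1

lemma le_withDensity_exp_llr {X : Type*} [MeasurableSpace X] (P Q : Measure X)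
    [IsProbabilityMeasure P] [IsProbabilityMeasure Q] (hQP : Q ≪ P) :
    Q ≤ P.withDensity fun x => ENNReal.ofReal (Real.exp (llr Q P x)) := by
  conv_lhs => rw [← Measure.withDensity_rnDeriv_eq Q P hQP]
  refine withDensity_mono ?_
  filter_upwards [Measure.rnDeriv_lt_top Q P] with x hx
  rw [← ENNReal.ofReal_toReal hx.ne]
  exact ENNReal.ofReal_le_ofReal (Real.le_exp_log _)

/-- If `Y ≤ id` has `Q`-mean larger than `α`, then the sample means eventually exceed `α`. -/
lemma ae_eventually_le_average {Q : Measure ℝ} [IsProbabilityMeasure Q] {α : ℝ} {Y : ℝ → ℝ}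
    (hY : Measurable Y) (hle : ∀ x, Y x ≤ x) (hint : Integrable Y Q) (hα : α < ∫ x, Y x ∂Q) :
    ∀ᵐ ω ∂(Measure.infinitePi fun _ : ℕ => Q),
      ∀ᶠ n : ℕ in atTop, α ≤ (∑ i ∈ Finset.range n, ω i) / n := by
  filter_upwards [ae_tendsto_average_infinitePi Q hY hint] with ω hω
  filter_upwards [hω.eventually_const_lt hα] with n hn
  refine hn.le.trans ?_
  gcongr
  exact hle _

lemma exists_lt_integral_min {Q : Measure ℝ} [IsProbabilityMeasure Q]
    (hneg : ∫⁻ x, ENNReal.ofReal (-x) ∂Q ≠ ⊤) (hpos : ∫⁻ x, ENNReal.ofReal x ∂Q = ⊤) (α : ℝ) :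
    ∃ k : ℕ, Integrable (fun x => min x (k : ℝ)) Q ∧ α < ∫ x, min x (k : ℝ) ∂Q := by
  have hmeas (k : ℕ) : Measurable fun x : ℝ => min x (k : ℝ) := by fun_prop
  have hn (k : ℕ) (x : ℝ) : ENNReal.ofReal (-min x (k : ℝ)) = ENNReal.ofReal (-x) := by
    rcases le_total x k with h | h
    · rw [min_eq_left h]
    · have : (0 : ℝ) ≤ k := k.cast_nonneg
      rw [min_eq_right h, ENNReal.ofReal_of_nonpos (by linarith),
        ENNReal.ofReal_of_nonpos (by linarith)]
  have hfin (k : ℕ) : ∫⁻ x, ENNReal.ofReal (min x (k : ℝ)) ∂Q ≠ ⊤ := by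
    refine ne_top_of_le_ne_top ENNReal.ofReal_ne_top (b := ENNReal.ofReal k) ?_
    calc _ ≤ ∫⁻ _, ENNReal.ofReal k ∂Q :=
          lintegral_mono fun x => ENNReal.ofReal_le_ofReal (min_le_right _ _)
      _ = _ := by simp
  have hint (k : ℕ) : Integrable (fun x => min x (k : ℝ)) Q := by
    refine ⟨(hmeas k).aestronglyMeasurable, ?_⟩
    rw [hasFiniteIntegral_iff_norm]
    calc ∫⁻ x, ENNReal.ofReal ‖min x (k : ℝ)‖ ∂Q
        ≤ ∫⁻ x, (ENNReal.ofReal (min x (k : ℝ)) + ENNReal.ofReal (-x)) ∂Q := by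
          refine lintegral_mono fun x => ?_
          rw [← hn k x, Real.norm_eq_abs]
          rcases le_total 0 (min x (k : ℝ)) with h | h
          · rw [abs_of_nonneg h]; exact le_self_add
          · rw [abs_of_nonpos h]; exact le_add_self
      _ = _ := lintegral_add_left (by fun_prop) _
      _ < ⊤ := ENNReal.add_lt_top.2 ⟨(hfin k).lt_top, hneg.lt_top⟩
  have hlim : Tendsto (fun k : ℕ => ∫⁻ x, ENNReal.ofReal (min x (k : ℝ)) ∂Q) atTop (𝓝 ⊤) := by
    rw [← hpos]
    refine lintegral_tendsto_of_tendsto_of_monotone (fun k => by fun_prop)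
      (.of_forall fun x k l hkl => ?_) (.of_forall fun x => ?_)
    · refine ENNReal.ofReal_le_ofReal (min_le_min le_rfl ?_)
      exact_mod_cast hkl
    · refine tendsto_const_nhds.congr' ?_
      filter_upwards [eventually_ge_atTop ⌈x⌉₊] with k hk
      rw [min_eq_left ((Nat.le_ceil x).trans (by exact_mod_cast hk))]
  set I := ∫⁻ x, ENNReal.ofReal (-x) ∂Q with hI
  obtain ⟨k, hk⟩ := (hlim.eventually_const_lt
    (show ENNReal.ofReal (α + I.toReal) < ⊤ from ENNReal.ofReal_lt_top)).exists
  refine ⟨k, hint k, ?_⟩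
  rw [integral_eq_lintegral_pos_part_sub_lintegral_neg_part (hint k)]
  simp only [hn]
  rw [← hI]
  rw [← ENNReal.ofReal_toReal (hfin k)] at hk
  linarith [(ENNReal.ofReal_lt_ofReal_iff'.1 hk).1]

lemma integrable_id_of_lintegral_ne_top {Q : Measure ℝ}
    (hneg : ∫⁻ x, ENNReal.ofReal (-x) ∂Q ≠ ⊤) (hpos : ∫⁻ x, ENNReal.ofReal x ∂Q ≠ ⊤) :
    Integrable (fun x : ℝ => x) Q := by
  refine ⟨measurable_id.aestronglyMeasurable, ?_⟩
  rw [hasFiniteIntegral_iff_norm]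
  calc ∫⁻ x, ENNReal.ofReal ‖x‖ ∂Q
      ≤ ∫⁻ x, (ENNReal.ofReal x + ENNReal.ofReal (-x)) ∂Q := by
        refine lintegral_mono fun x => ?_
        rw [Real.norm_eq_abs]
        rcases le_total 0 x with h | h
        · rw [abs_of_nonneg h]; exact le_self_add
        · rw [abs_of_nonpos h]; exact le_add_self
    _ = _ := lintegral_add_left (by fun_prop) _
    _ < ⊤ := ENNReal.add_lt_top.2 ⟨hpos.lt_top, hneg.lt_top⟩

lemma coe_lintegral_sub_eq_integral {Q : Measure ℝ}
    (hneg : ∫⁻ x, ENNReal.ofReal (-x) ∂Q ≠ ⊤) (hpos : ∫⁻ x, ENNReal.ofReal x ∂Q ≠ ⊤) :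
    ((∫⁻ x, ENNReal.ofReal x ∂Q : ℝ≥0∞) : EReal) - ((∫⁻ x, ENNReal.ofReal (-x) ∂Q : ℝ≥0∞) : EReal)
      = ((∫ x, x ∂Q : ℝ) : EReal) := by
  rw [integral_eq_lintegral_pos_part_sub_lintegral_neg_part
    (integrable_id_of_lintegral_ne_top hneg hpos), EReal.coe_sub,
    EReal.coe_ennreal_toReal hpos, EReal.coe_ennreal_toReal hneg]

/-- If `Q` has mean exactly `α`, shifting a small amount of mass towards `(α, ∞)` raises the mean
above `α` at a small cost in relative entropy. -/
lemma eventually_exp_le_of_integral_eq (P Q : Measure ℝ) [IsProbabilityMeasure P]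
    [IsProbabilityMeasure Q] {α c : ℝ} {ℓ : ℝ → ℝ} (hℓ : Measurable ℓ) (hint : Integrable ℓ Q)
    (hQP : Q ≤ P.withDensity fun x => ENNReal.ofReal (Real.exp (ℓ x)))
    (hid : Integrable (fun x : ℝ => x) Q) (hα : ∫ x, x ∂Q = α) (hq : Q (Set.Ioi α) ≠ 0)
    (hc : ∫ x, ℓ x ∂Q < c) :
    ∀ᶠ n : ℕ in atTop, ENNReal.ofReal (Real.exp (-(n * c))) ≤
      (Measure.pi fun _ : Fin n => P) {x | α ≤ (∑ i, x i) / n} := by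
  set U : Measure ℝ := Q[|Set.Ioi α] with hU
  have : IsProbabilityMeasure U := cond_isProbabilityMeasure hq
  set q := (Q (Set.Ioi α))⁻¹
  have hqtop : q ≠ ⊤ := ENNReal.inv_ne_top.2 hq
  have hUQ : U ≤ q • Q := by
    rw [hU, ProbabilityTheory.cond]
    intro s
    simp only [Measure.smul_apply, smul_eq_mul]
    gcongr
    exact Measure.restrict_le_self
  have hUint {g : ℝ → ℝ} (hg : Integrable g Q) : Integrable g U :=
    (hg.smul_measure hqtop).mono_measure hUQ
  have hUα : α < ∫ x, x ∂U := by
    have hpos : ∀ᵐ x ∂U, 0 < x - α := by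
      have : ∀ᵐ x ∂U, x ∈ Set.Ioi α := ae_cond_mem measurableSet_Ioi
      filter_upwards [this] with x hx using sub_pos.2 hx
    have h := (integral_pos_iff_support_of_nonneg_ae (hpos.mono fun x hx => hx.le)
      ((hUint hid).sub (integrable_const α))).2 (by
        rw [measure_congr (eventuallyEq_univ.2 (by
          filter_upwards [hpos] with x hx
          exact hx.ne')), measure_univ]
        exact one_pos)
    rw [integral_sub (hUint hid) (integrable_const α)] at h
    simpa using h
  obtain ⟨ε, hε, hε0, hε1⟩ : ∃ ε : ℝ, (1 - ε) * ∫ x, ℓ x ∂Q + ε * ∫ x, ℓ x ∂U + ε * q.toReal < c ∧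
      0 < ε ∧ ε < 1 := by
    have hcont : Tendsto (fun ε : ℝ => (1 - ε) * ∫ x, ℓ x ∂Q + ε * ∫ x, ℓ x ∂U + ε * q.toReal)
        (𝓝[>] 0) (𝓝 (∫ x, ℓ x ∂Q)) := by
      have : Continuous fun ε : ℝ => (1 - ε) * ∫ x, ℓ x ∂Q + ε * ∫ x, ℓ x ∂U + ε * q.toReal := by
        fun_prop
      simpa using (this.tendsto 0).mono_left nhdsWithin_le_nhds
    exact ((hcont.eventually_lt_const hc).and (Ioo_mem_nhdsGT one_pos)).exists
  set S : Measure ℝ := ENNReal.ofReal (1 - ε) • Q + ENNReal.ofReal ε • U with hS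
  have hSprob : IsProbabilityMeasure S := by
    constructor
    simp only [hS, Measure.add_apply, Measure.smul_apply, measure_univ, smul_eq_mul, mul_one]
    rw [← ENNReal.ofReal_add (by linarith) hε0.le]
    simp
  have hSint {g : ℝ → ℝ} (hg : Integrable g Q) : Integrable g S :=
    (hg.smul_measure ENNReal.ofReal_ne_top).add_measure
      ((hUint hg).smul_measure ENNReal.ofReal_ne_top)
  have hSeq {g : ℝ → ℝ} (hg : Integrable g Q) :
      ∫ x, g x ∂S = (1 - ε) * ∫ x, g x ∂Q + ε * ∫ x, g x ∂U := by
    rw [hS, integral_add_measure (hg.smul_measure ENNReal.ofReal_ne_top)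
      ((hUint hg).smul_measure ENNReal.ofReal_ne_top), integral_smul_measure, integral_smul_measure,
      ENNReal.toReal_ofReal (by linarith), ENNReal.toReal_ofReal hε0.le, smul_eq_mul, smul_eq_mul]
  refine eventually_exp_le_of_ae_eventually P S (ℓ := fun x => ℓ x + ε * q.toReal) (by fun_prop)
    ((hSint hint).add (integrable_const _)) ?_
    (ae_eventually_le_average measurable_id (fun _ => le_rfl) (hSint hid) ?_) ?_
  · have hcoef : ENNReal.ofReal (1 - ε) + ENNReal.ofReal ε * q ≤
        ENNReal.ofReal (Real.exp (ε * q.toReal)) := by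
      conv_lhs => rw [← ENNReal.ofReal_toReal hqtop]
      rw [← ENNReal.ofReal_mul hε0.le, ← ENNReal.ofReal_add (by linarith) (by positivity)]
      refine ENNReal.ofReal_le_ofReal ?_
      have := Real.add_one_le_exp (ε * q.toReal)
      linarith
    have hdens : (P.withDensity fun x => ENNReal.ofReal (Real.exp (ℓ x + ε * q.toReal))) =
        ENNReal.ofReal (Real.exp (ε * q.toReal)) •
          P.withDensity fun x => ENNReal.ofReal (Real.exp (ℓ x)) := by
      rw [← withDensity_smul _ (by fun_prop)]
      congr 1
      ext x
      rw [Pi.smul_apply, smul_eq_mul, ← ENNReal.ofReal_mul (Real.exp_pos _).le, ← Real.exp_add,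
        add_comm]
    rw [hdens]
    intro s
    calc S s = ENNReal.ofReal (1 - ε) * Q s + ENNReal.ofReal ε * U s := by
          simp [hS]
      _ ≤ ENNReal.ofReal (1 - ε) * Q s + ENNReal.ofReal ε * (q * Q s) := by
          gcongr
          exact hUQ s
      _ = (ENNReal.ofReal (1 - ε) + ENNReal.ofReal ε * q) * Q s := by ring
      _ ≤ ENNReal.ofReal (Real.exp (ε * q.toReal)) *
          (P.withDensity fun x => ENNReal.ofReal (Real.exp (ℓ x))) s := by
          gcongr
      _ = _ := by simp
  · change α < ∫ x, x ∂S
    rw [hSeq hid, hα]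
    nlinarith
  · rw [integral_add (hSint hint) (integrable_const _), hSeq hint]
    simpa using hε

/-- Cramér's lower bound: `ℙ (S_n / n ≥ α) ≥ exp (-n c)` eventually, if `c > D(Q‖P)` for some
`Q` whose mean is well defined and at least `α`. -/
lemma eventually_exp_le_of_relEnt_lt (P Q : Measure ℝ) [IsProbabilityMeasure P]
    [IsProbabilityMeasure Q] {α c : ℝ} (hneg : ∫⁻ x, ENNReal.ofReal (-x) ∂Q ≠ ⊤)
    (hα : (α : EReal) ≤ ((∫⁻ x, ENNReal.ofReal x ∂Q : ℝ≥0∞) : EReal)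
      - ((∫⁻ x, ENNReal.ofReal (-x) ∂Q : ℝ≥0∞) : EReal))
    (hc : relEnt Q P < ENNReal.ofReal c) :
    ∀ᶠ n : ℕ in atTop, ENNReal.ofReal (Real.exp (-(n * c))) ≤
      (Measure.pi fun _ : Fin n => P) {x | α ≤ (∑ i, x i) / n} := by
  unfold relEnt at hc
  split_ifs at hc with h
  swap
  · simp at hc
  obtain ⟨hac, hint⟩ := h
  have hlt : ∫ x, llr Q P x ∂Q < c := (ENNReal.ofReal_lt_ofReal_iff'.1 hc).1
  have hdens := le_withDensity_exp_llr P Q hac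
  have hmeas : Measurable (llr Q P) := measurable_llr Q P
  by_cases hpos : ∫⁻ x, ENNReal.ofReal x ∂Q = ⊤
  · obtain ⟨k, hk, hk'⟩ := exists_lt_integral_min hneg hpos α
    exact eventually_exp_le_of_ae_eventually P Q hmeas hint hdens
      (ae_eventually_le_average (by fun_prop) (fun x => min_le_left _ _) hk hk') hlt
  have hid := integrable_id_of_lintegral_ne_top hneg hpos
  rw [coe_lintegral_sub_eq_integral hneg hpos, EReal.coe_le_coe_iff] at hα
  rcases hα.lt_or_eq with hα | hα
  · exact eventually_exp_le_of_ae_eventually P Q hmeas hint hdens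
      (ae_eventually_le_average measurable_id (fun _ => le_rfl) hid hα) hlt
  by_cases hq : Q (Set.Ioi α) = 0
  · have hle : ∀ᵐ x ∂Q, 0 ≤ α - x := by
      rw [ae_iff]
      convert hq using 2
      ext x
      simp
    have hzero : ∀ᵐ x ∂Q, α - x = 0 := by
      refine (integral_eq_zero_iff_of_nonneg_ae hle ((integrable_const α).sub hid)).1 ?_
      rw [integral_sub (integrable_const α) hid, ← hα]
      simp
    refine eventually_exp_le_of_ae_eventually P Q hmeas hint hdens ?_ hlt
    have hall : ∀ᵐ ω ∂(Measure.infinitePi fun _ : ℕ => Q), ∀ i, α - ω i = 0 :=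
      ae_all_iff.2 fun i =>
        (measurePreserving_eval_infinitePi (fun _ : ℕ => Q) i).quasiMeasurePreserving.ae hzero
    filter_upwards [hall] with ω hω
    filter_upwards [eventually_gt_atTop 0] with n hn
    have hn' : (n : ℝ) ≠ 0 := by exact_mod_cast hn.ne'
    rw [Finset.sum_congr rfl fun i _ => (sub_eq_zero.1 (hω i)).symm]
    simp [hn']
  · exact eventually_exp_le_of_integral_eq P Q hmeas hint hdens hid hα.symm hq hlt

/-- The average of the one-dimensional marginals of a measure on a finite power. -/
noncomputable def averageMarginal {X : Type*} [MeasurableSpace X] {n : ℕ}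
    (ν : Measure (Fin n → X)) : Measure X :=
  (n : ℝ≥0∞)⁻¹ • ∑ i, ν.map fun x => x i

lemma averageMarginal_apply {X : Type*} [MeasurableSpace X] {n : ℕ} (ν : Measure (Fin n → X))
    {s : Set X} (hs : MeasurableSet s) :
    averageMarginal ν s = (n : ℝ≥0∞)⁻¹ * ∑ i, ν ((fun x => x i) ⁻¹' s) := by
  simp only [averageMarginal, Measure.smul_apply, Measure.finsetSum_apply, smul_eq_mul]
  congr 1
  exact Finset.sum_congr rfl fun i _ => Measure.map_apply (measurable_pi_apply i) hs

lemma isProbabilityMeasure_averageMarginal {X : Type*} [MeasurableSpace X] {n : ℕ} (hn : n ≠ 0)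
    (ν : Measure (Fin n → X)) [IsProbabilityMeasure ν] :
    IsProbabilityMeasure (averageMarginal ν) := by
  constructor
  rw [averageMarginal_apply ν .univ]
  simpa using ENNReal.inv_mul_cancel (by exact_mod_cast hn) (ENNReal.natCast_ne_top n)

lemma mul_integral_averageMarginal {X : Type*} [MeasurableSpace X] {n : ℕ} (hn : n ≠ 0)
    (ν : Measure (Fin n → X)) {g : X → ℝ} (hg : Measurable g)
    (hint : Integrable g (averageMarginal ν)) :
    Integrable (fun x => ∑ i, g (x i)) ν ∧
      n * ∫ x, g x ∂(averageMarginal ν) = ∫ x, ∑ i, g (x i) ∂ν := by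
  have hn' : (n : ℝ≥0∞)⁻¹ ≠ 0 := ENNReal.inv_ne_zero.2 (ENNReal.natCast_ne_top n)
  have hn'' : (n : ℝ≥0∞)⁻¹ ≠ ⊤ := ENNReal.inv_ne_top.2 (by exact_mod_cast hn)
  have hsum : Integrable g (∑ i, ν.map fun x => x i) :=
    (integrable_smul_measure hn' hn'').1 hint
  have hmap (i : Fin n) : Integrable g (ν.map fun x => x i) :=
    (integrable_finsetSum_measure.1 hsum) i (Finset.mem_univ i)
  have hcomp (i : Fin n) : Integrable (fun x : Fin n → X => g (x i)) ν :=
    (integrable_map_measure hg.aestronglyMeasurable (measurable_pi_apply i).aemeasurable).1 (hmap i)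
  refine ⟨integrable_finsetSum _ fun i _ => hcomp i, ?_⟩
  rw [averageMarginal, integral_smul_measure, integral_finsetSum_measure fun i _ => hmap i,
    integral_finsetSum _ fun i _ => hcomp i, ENNReal.toReal_inv, ENNReal.toReal_natCast,
    smul_eq_mul, mul_inv_cancel_left₀ (by exact_mod_cast hn)]
  exact Finset.sum_congr rfl fun i _ =>
    integral_map (measurable_pi_apply i).aemeasurable hg.aestronglyMeasurable

lemma averageMarginal_cond_le {X : Type*} [MeasurableSpace X] (P : Measure X)
    [IsProbabilityMeasure P] {n : ℕ} (hn : n ≠ 0) (A : Set (Fin n → X)) (hA : MeasurableSet A) :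
    averageMarginal ((Measure.pi fun _ : Fin n => P)[|A]) ≤
      ((Measure.pi fun _ : Fin n => P) A)⁻¹ • P := by
  refine Measure.le_iff.2 fun s hs => ?_
  rw [averageMarginal_apply _ hs, Measure.smul_apply, smul_eq_mul]
  calc (n : ℝ≥0∞)⁻¹ * ∑ i, ((Measure.pi fun _ : Fin n => P)[|A]) ((fun x => x i) ⁻¹' s)
      ≤ (n : ℝ≥0∞)⁻¹ * ∑ _i : Fin n, ((Measure.pi fun _ : Fin n => P) A)⁻¹ * P s := by
        gcongr with i
        rw [cond_apply hA]
        gcongr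
        refine (measure_mono Set.inter_subset_right).trans_eq ?_
        exact (measurePreserving_eval (fun _ : Fin n => P) i).measure_preimage hs.nullMeasurableSet
    _ = ((Measure.pi fun _ : Fin n => P) A)⁻¹ * P s := by
        rw [Finset.sum_const, Finset.card_univ, Fintype.card_fin, nsmul_eq_mul, ← mul_assoc,
          ENNReal.inv_mul_cancel (by exact_mod_cast hn) (ENNReal.natCast_ne_top n), one_mul]

/-- Gibbs variational inequality for `Pⁿ` conditioned on `A`, on functions of the form
`∑ log (F (x i))`. -/
lemma mul_integral_log_averageMarginal_le {X : Type*} [MeasurableSpace X] (P : Measure X)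
    [IsProbabilityMeasure P] {n : ℕ} (hn : n ≠ 0) (A : Set (Fin n → X))
    (hPA : (Measure.pi fun _ : Fin n => P) A ≠ 0) {F : X → ℝ} (hF : Measurable F) {a b : ℝ}
    (ha : 0 < a) (hFa : ∀ x, a ≤ F x) (hFb : ∀ x, F x ≤ b) :
    n * ∫ x, Real.log (F x) ∂(averageMarginal ((Measure.pi fun _ : Fin n => P)[|A])) ≤
      n * Real.log (∫ x, F x ∂P) - Real.log ((Measure.pi fun _ : Fin n => P) A).toReal := by
  set μ := Measure.pi fun _ : Fin n => P with hμ
  have : IsProbabilityMeasure (μ[|A]) := cond_isProbabilityMeasure hPA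
  have := isProbabilityMeasure_averageMarginal hn (μ[|A])
  have hlog : Measurable fun x => Real.log (F x) := Real.measurable_log.comp hF
  have hFpos (x : X) : 0 < F x := ha.trans_le (hFa x)
  have hlogint : Integrable (fun x => Real.log (F x)) (averageMarginal (μ[|A])) := by
    refine Integrable.of_bound hlog.aestronglyMeasurable (max |Real.log a| |Real.log b|)
      (.of_forall fun x => ?_)
    exact abs_le_max_abs_abs (Real.log_le_log ha (hFa x)) (Real.log_le_log (hFpos x) (hFb x))
  obtain ⟨hsum, heq⟩ := mul_integral_averageMarginal hn (μ[|A]) hlog hlogint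
  have hexp (x : Fin n → X) : Real.exp (∑ i, Real.log (F (x i))) = ∏ i, F (x i) := by
    rw [Real.exp_sum]
    exact Finset.prod_congr rfl fun i _ => Real.exp_log (hFpos _)
  have hprod (ρ : Measure (Fin n → X)) [IsFiniteMeasure ρ] :
      Integrable (fun x : Fin n → X => ∏ i, F (x i)) ρ := by
    refine Integrable.of_bound (Measurable.aestronglyMeasurable (by fun_prop)) (b ^ n)
      (.of_forall fun x => ?_)
    rw [Real.norm_of_nonneg (Finset.prod_nonneg fun i _ => (hFpos _).le)]
    calc ∏ i, F (x i) ≤ ∏ _i : Fin n, b :=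
          Finset.prod_le_prod (fun i _ => (hFpos _).le) fun i _ => hFb _
      _ = b ^ n := by simp
  have hjensen : Real.exp (∫ x, ∑ i, Real.log (F (x i)) ∂(μ[|A])) ≤
      ∫ x, ∏ i, F (x i) ∂(μ[|A]) := by
    have h := convexOn_exp.map_integral_le (μ := μ[|A]) Real.continuous_exp.continuousOn
      isClosed_univ (f := fun x => ∑ i, Real.log (F (x i))) (.of_forall fun _ => Set.mem_univ _)
      hsum (by simpa only [Function.comp_def, hexp] using hprod _)
    simpa only [hexp] using h
  have hle : ∫ x, ∏ i, F (x i) ∂(μ[|A]) ≤ (μ A).toReal⁻¹ * (∫ x, F x ∂P) ^ n := by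
    rw [ProbabilityTheory.cond, integral_smul_measure, smul_eq_mul, ENNReal.toReal_inv]
    gcongr
    calc ∫ x in A, ∏ i, F (x i) ∂μ ≤ ∫ x, ∏ i, F (x i) ∂μ :=
          setIntegral_le_integral (hprod μ)
            (.of_forall fun x => Finset.prod_nonneg fun i _ => (hFpos _).le)
      _ = (∫ x, F x ∂P) ^ n := by
          rw [hμ, integral_fintype_prod_eq_pow, Fintype.card_fin]
  have hμA : 0 < (μ A).toReal := ENNReal.toReal_pos hPA (measure_ne_top _ _)
  have hFint : Integrable F P := by
    refine Integrable.of_bound hF.aestronglyMeasurable b (.of_forall fun x => ?_)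
    rw [Real.norm_of_nonneg (hFpos x).le]
    exact hFb x
  have hIpos : 0 < ∫ x, F x ∂P := by
    refine ha.trans_le ?_
    calc a = ∫ _, a ∂P := by simp
      _ ≤ _ := integral_mono (integrable_const a) hFint hFa
  rw [heq]
  have h := Real.log_le_log (Real.exp_pos _) (hjensen.trans hle)
  rw [Real.log_exp, Real.log_mul (inv_ne_zero hμA.ne') (pow_pos hIpos n).ne', Real.log_inv,
    Real.log_pow] at h
  linarith

/-- The average marginal of `Pⁿ` conditioned on `A` has relative entropy at most
`-(1/n) log Pⁿ(A)`. -/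
lemma relEnt_averageMarginal_cond_le {X : Type*} [MeasurableSpace X] (P : Measure X)
    [IsProbabilityMeasure P] {n : ℕ} (hn : n ≠ 0) (A : Set (Fin n → X)) (hA : MeasurableSet A)
    (hPA : (Measure.pi fun _ : Fin n => P) A ≠ 0) :
    relEnt (averageMarginal ((Measure.pi fun _ : Fin n => P)[|A])) P ≤
      ENNReal.ofReal (-((n : ℝ)⁻¹ * Real.log ((Measure.pi fun _ : Fin n => P) A).toReal)) := by
  have hle := averageMarginal_cond_le P hn A hA
  have hgibbs {F : X → ℝ} (hF : Measurable F) {a b : ℝ} :=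
    mul_integral_log_averageMarginal_le P hn A hPA hF (a := a) (b := b)
  set p := (Measure.pi fun _ : Fin n => P) A
  have : IsProbabilityMeasure ((Measure.pi fun _ : Fin n => P)[|A]) :=
    cond_isProbabilityMeasure hPA
  have := isProbabilityMeasure_averageMarginal hn ((Measure.pi fun _ : Fin n => P)[|A])
  set Q := averageMarginal ((Measure.pi fun _ : Fin n => P)[|A])
  have hac : Q ≪ P := (Measure.absolutelyContinuous_of_le hle).trans
    Measure.smul_absolutelyContinuous
  have hptop : p⁻¹ ≠ ⊤ := ENNReal.inv_ne_top.2 hPA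
  have hdens : ∀ᵐ x ∂P, Q.rnDeriv P x ≤ p⁻¹ := by
    refine ae_le_of_forall_setLIntegral_le_of_sigmaFinite (Measure.measurable_rnDeriv _ _) ?_
    intro s hs _
    refine (Measure.setLIntegral_rnDeriv_le s).trans ?_
    simpa using hle s
  set K := p⁻¹.toReal
  have hK0 : 0 ≤ K := ENNReal.toReal_nonneg
  have hdens' : ∀ᵐ x ∂P, (Q.rnDeriv P x).toReal ≤ K :=
    hdens.mono fun x hx => ENNReal.toReal_mono hptop hx
  have hint : Integrable (llr Q P) Q := by
    rw [← integrable_rnDeriv_mul_log_iff hac]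
    obtain ⟨C, hC⟩ := (isCompact_Icc (a := (0 : ℝ)) (b := K)).exists_bound_of_continuousOn
      Real.continuous_mul_log.continuousOn
    refine Integrable.of_bound (Measurable.aestronglyMeasurable (by fun_prop)) C ?_
    filter_upwards [hdens'] with x hx using hC _ ⟨ENNReal.toReal_nonneg, hx⟩
  rw [relEnt, if_pos ⟨hac, hint⟩]
  refine ENNReal.ofReal_le_ofReal (le_of_forall_pos_le_add fun ε hε => ?_)
  let F (x : X) : ℝ := min (Q.rnDeriv P x).toReal K + ε
  have hFm : Measurable F := by fun_prop
  have hFε (x : X) : ε ≤ F x := le_add_of_nonneg_left (le_min ENNReal.toReal_nonneg hK0)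
  have hFb (x : X) : F x ≤ K + ε := add_le_add_left (min_le_right _ _) ε
  have hFP : F =ᵐ[P] fun x => (Q.rnDeriv P x).toReal + ε := by
    filter_upwards [hdens'] with x hx
    simp only [F, min_eq_left hx]
  have hFint : ∫ x, F x ∂P = 1 + ε := by
    rw [integral_congr_ae hFP, integral_add Measure.integrable_toReal_rnDeriv (integrable_const ε),
      Measure.integral_toReal_rnDeriv hac]
    simp
  have hlogint : Integrable (fun x => Real.log (F x)) Q := by
    refine Integrable.of_bound (Real.measurable_log.comp hFm).aestronglyMeasurable
      (max |Real.log ε| |Real.log (K + ε)|) (.of_forall fun x => ?_)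
    exact abs_le_max_abs_abs (Real.log_le_log hε (hFε x))
      (Real.log_le_log (hε.trans_le (hFε x)) (hFb x))
  have hmono : ∫ x, llr Q P x ∂Q ≤ ∫ x, Real.log (F x) ∂Q := by
    refine integral_mono_ae hint hlogint ?_
    filter_upwards [Measure.rnDeriv_pos hac, hac.ae_le (Measure.rnDeriv_lt_top Q P),
      hac.ae_le hFP] with x hx hx' hxF
    rw [llr, hxF]
    exact Real.log_le_log (ENNReal.toReal_pos hx.ne' hx'.ne) (by linarith)
  have h := hgibbs hFm hε hFε hFb
  rw [hFint] at h
  have hlog : Real.log (1 + ε) ≤ ε := by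
    linarith [Real.log_le_sub_one_of_pos (show 0 < 1 + ε by linarith)]
  have hn0 : (0 : ℝ) < n := by exact_mod_cast Nat.pos_of_ne_zero hn
  have h1 : n * ∫ x, llr Q P x ∂Q ≤ n * ε - Real.log p.toReal := by
    linarith [mul_le_mul_of_nonneg_left hmono hn0.le, mul_le_mul_of_nonneg_left hlog hn0.le]
  refine le_of_mul_le_mul_left (h1.trans_eq ?_) hn0
  field_simp
  ring

/-- An event on which the sample mean is at least `α` and the coordinates are bounded below
provides a competitor in the definition of the rate function. -/
lemma exists_relEnt_le_of_subset (P : Measure ℝ) [IsProbabilityMeasure P] {n : ℕ} (hn : n ≠ 0)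
    {α M : ℝ} {A : Set (Fin n → ℝ)} (hA : MeasurableSet A)
    (hPA : (Measure.pi fun _ : Fin n => P) A ≠ 0) (hAα : ∀ x ∈ A, α ≤ (∑ i, x i) / n)
    (hAM : ∀ x ∈ A, ∀ i, -M ≤ x i) :
    ∃ Q : Measure ℝ, IsProbabilityMeasure Q ∧ ∫⁻ x, ENNReal.ofReal (-x) ∂Q ≠ ⊤ ∧
      (α : EReal) ≤ ((∫⁻ x, ENNReal.ofReal x ∂Q : ℝ≥0∞) : EReal)
        - ((∫⁻ x, ENNReal.ofReal (-x) ∂Q : ℝ≥0∞) : EReal) ∧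
      relEnt Q P ≤
        ENNReal.ofReal (-((n : ℝ)⁻¹ * Real.log ((Measure.pi fun _ : Fin n => P) A).toReal)) := by
  set ν := (Measure.pi fun _ : Fin n => P)[|A]
  have : IsProbabilityMeasure ν := cond_isProbabilityMeasure hPA
  have hQ := isProbabilityMeasure_averageMarginal hn ν
  have hνA : ∀ᵐ x ∂ν, x ∈ A := ae_cond_mem hA
  have hbdd : ∀ᵐ x ∂(averageMarginal ν), -M ≤ x := by
    rw [ae_iff, averageMarginal_apply ν (by measurability)]
    simp only [mul_eq_zero, Finset.sum_eq_zero_iff]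
    exact .inr fun i _ => ae_iff.1 (hνA.mono fun x hx => hAM x hx i)
  have hneg : ∫⁻ x, ENNReal.ofReal (-x) ∂(averageMarginal ν) ≠ ⊤ := by
    refine ne_top_of_le_ne_top (ENNReal.ofReal_ne_top (r := M)) ?_
    calc ∫⁻ x, ENNReal.ofReal (-x) ∂(averageMarginal ν)
        ≤ ∫⁻ _, ENNReal.ofReal M ∂(averageMarginal ν) :=
          lintegral_mono_ae (hbdd.mono fun x hx => ENNReal.ofReal_le_ofReal (by linarith))
      _ = _ := by simp
  refine ⟨averageMarginal ν, hQ, hneg, ?_, relEnt_averageMarginal_cond_le P hn A hA hPA⟩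
  by_cases hpos : ∫⁻ x, ENNReal.ofReal x ∂(averageMarginal ν) = ⊤
  · rw [hpos, ← EReal.coe_ennreal_toReal hneg]
    simp
  rw [coe_lintegral_sub_eq_integral hneg hpos, EReal.coe_le_coe_iff]
  obtain ⟨hsum, heq⟩ := mul_integral_averageMarginal hn ν measurable_id
    (integrable_id_of_lintegral_ne_top hneg hpos)
  simp only [id] at hsum heq
  have hn0 : (0 : ℝ) < n := by exact_mod_cast Nat.pos_of_ne_zero hn
  refine le_of_mul_le_mul_left ?_ hn0
  rw [heq]
  calc n * α = ∫ _, n * α ∂ν := by simp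
    _ ≤ _ := integral_mono_ae (integrable_const _) hsum (by
      filter_upwards [hνA] with x hx
      have := (le_div_iff₀ hn0).1 (hAα x hx)
      linarith)

lemma neg_inv_mul_log_eq {n : ℕ} {p : ℝ≥0∞} (h0 : p ≠ 0) (htop : p ≠ ⊤) :
    (-(((n : ℝ)⁻¹ : ℝ) : EReal)) * ENNReal.log p =
      ((-((n : ℝ)⁻¹ * Real.log p.toReal) : ℝ) : EReal) := by
  rw [ENNReal.log_pos_real h0 htop, ← EReal.coe_neg, ← EReal.coe_mul, neg_mul]

lemma neg_inv_mul_log_zero {n : ℕ} (hn : n ≠ 0) :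
    (-(((n : ℝ)⁻¹ : ℝ) : EReal)) * ENNReal.log 0 = ⊤ := by
  rw [ENNReal.log_zero, ← EReal.coe_neg]
  refine EReal.coe_mul_bot_of_neg ?_
  have : (0 : ℝ) < n := by exact_mod_cast Nat.pos_of_ne_zero hn
  simpa using this

lemma neg_inv_mul_log_le {n : ℕ} (hn : n ≠ 0) {p : ℝ≥0∞} (htop : p ≠ ⊤) {c : ℝ}
    (h : ENNReal.ofReal (Real.exp (-(n * c))) ≤ p) :
    (-(((n : ℝ)⁻¹ : ℝ) : EReal)) * ENNReal.log p ≤ c := by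
  have hn0 : (0 : ℝ) < n := by exact_mod_cast Nat.pos_of_ne_zero hn
  have h0 : p ≠ 0 := ((ENNReal.ofReal_pos.2 (Real.exp_pos _)).trans_le h).ne'
  rw [neg_inv_mul_log_eq h0 htop, EReal.coe_le_coe_iff]
  have h1 := (Real.le_log_iff_exp_le (ENNReal.toReal_pos h0 htop)).2
    ((ENNReal.ofReal_le_iff_le_toReal htop).1 h)
  refine le_of_mul_le_mul_left ?_ hn0
  rw [mul_neg, mul_inv_cancel_left₀ hn0.ne']
  linarith

lemma exp_lt_of_neg_inv_mul_log_lt {n : ℕ} (hn : n ≠ 0) {p : ℝ≥0∞} (htop : p ≠ ⊤) {c : ℝ}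
    (h : (-(((n : ℝ)⁻¹ : ℝ) : EReal)) * ENNReal.log p < c) :
    ENNReal.ofReal (Real.exp (-(n * c))) < p := by
  have hn0 : (0 : ℝ) < n := by exact_mod_cast Nat.pos_of_ne_zero hn
  rcases eq_or_ne p 0 with rfl | h0
  · rw [neg_inv_mul_log_zero hn] at h
    exact absurd h not_top_lt
  rw [neg_inv_mul_log_eq h0 htop, EReal.coe_lt_coe_iff] at h
  rw [ENNReal.ofReal_lt_iff_lt_toReal (Real.exp_pos _).le htop,
    ← Real.lt_log_iff_exp_lt (ENNReal.toReal_pos h0 htop)]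
  have := mul_lt_mul_of_pos_left h hn0
  rw [mul_neg, mul_inv_cancel_left₀ hn0.ne'] at this
  linarith

/-- Cramér's upper bound, for every sample size. -/
lemma exists_relEnt_le_of_exp_lt (P : Measure ℝ) [IsProbabilityMeasure P] {n : ℕ} (hn : n ≠ 0)
    {α c : ℝ} (h : ENNReal.ofReal (Real.exp (-(n * c))) <
      (Measure.pi fun _ : Fin n => P) {x | α ≤ (∑ i, x i) / n}) :
    ∃ Q : Measure ℝ, IsProbabilityMeasure Q ∧ ∫⁻ x, ENNReal.ofReal (-x) ∂Q ≠ ⊤ ∧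
      (α : EReal) ≤ ((∫⁻ x, ENNReal.ofReal x ∂Q : ℝ≥0∞) : EReal)
        - ((∫⁻ x, ENNReal.ofReal (-x) ∂Q : ℝ≥0∞) : EReal) ∧
      relEnt Q P ≤ ENNReal.ofReal c := by
  let A (M : ℕ) : Set (Fin n → ℝ) := {x | α ≤ (∑ i, x i) / n} ∩ {x | ∀ i, -(M : ℝ) ≤ x i}
  have hmono : Monotone A := fun M N hMN x hx => ⟨hx.1, fun i => by
    have : (M : ℝ) ≤ N := by exact_mod_cast hMN
    linarith [hx.2 i]⟩
  have hunion : ⋃ M, A M = {x | α ≤ (∑ i, x i) / n} := by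
    refine Set.Subset.antisymm (Set.iUnion_subset fun M => Set.inter_subset_left) fun x hx => ?_
    obtain ⟨M, hM⟩ := exists_nat_ge (∑ i, |x i|)
    refine Set.mem_iUnion.2 ⟨M, hx, fun i => ?_⟩
    have := Finset.single_le_sum (f := fun i => |x i|) (fun i _ => abs_nonneg _) (Finset.mem_univ i)
    linarith [neg_abs_le (x i)]
  have hlim := tendsto_measure_iUnion_atTop (μ := Measure.pi fun _ : Fin n => P) hmono
  rw [hunion] at hlim
  obtain ⟨M, hM⟩ := (hlim.eventually_const_lt h).exists
  have hM' : ENNReal.ofReal (Real.exp (-(n * c))) < (Measure.pi fun _ : Fin n => P) (A M) := hM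
  have hA : MeasurableSet (A M) :=
    (measurableSet_le (by fun_prop) (by fun_prop)).inter (by
      rw [Set.ofPred_forall]
      exact .iInter fun i => measurableSet_le (by fun_prop) (by fun_prop))
  have h0 := (bot_le.trans_lt hM').ne'
  obtain ⟨Q, hQ, h1, h2, h3⟩ := exists_relEnt_le_of_subset P hn hA h0 (fun x hx => hx.1)
    (fun x hx => hx.2)
  refine ⟨Q, hQ, h1, h2, h3.trans (ENNReal.ofReal_le_ofReal ?_)⟩
  have h4 := neg_inv_mul_log_le hn (measure_ne_top _ _) hM'.le
  rwa [neg_inv_mul_log_eq h0 (measure_ne_top _ _), EReal.coe_le_coe_iff] at h4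

/-- **Cramér's theorem (simple version).** For i.i.d. real random variables with law `P`,
`-(1/n) log ℙ{(1/n)∑ X_i ≥ α}` converges to
`γ₊(α) = inf { D(Q‖P) : E_Q[X] well-defined and ≥ α }`. -/
theorem cramer_simple (P : Measure ℝ) [IsProbabilityMeasure P] (α : ℝ) :
    Tendsto
      (fun n : ℕ =>
        (-(((n : ℝ)⁻¹ : ℝ) : EReal)) *
          ENNReal.log ((Measure.pi fun _ : Fin n => P) {x | α ≤ (∑ i, x i) / n}))
      atTop
      (𝓝 (((⨅ (Q : Measure ℝ) (_ : IsProbabilityMeasure Q)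
              (_ : ∫⁻ x, ENNReal.ofReal (-x) ∂Q ≠ ⊤)
              (_ : (α : EReal) ≤ ((∫⁻ x, ENNReal.ofReal x ∂Q : ℝ≥0∞) : EReal)
                    - ((∫⁻ x, ENNReal.ofReal (-x) ∂Q : ℝ≥0∞) : EReal)),
              relEnt Q P) : ℝ≥0∞) : EReal)) := by
  set γ : ℝ≥0∞ := ⨅ (Q : Measure ℝ) (_ : IsProbabilityMeasure Q)
    (_ : ∫⁻ x, ENNReal.ofReal (-x) ∂Q ≠ ⊤)
    (_ : (α : EReal) ≤ ((∫⁻ x, ENNReal.ofReal x ∂Q : ℝ≥0∞) : EReal)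
      - ((∫⁻ x, ENNReal.ofReal (-x) ∂Q : ℝ≥0∞) : EReal)), relEnt Q P with hγ
  refine tendsto_order.2 ⟨fun a ha => ?_, fun a ha => ?_⟩
  · filter_upwards [eventually_ne_atTop 0] with n hn
    refine ha.trans_le (le_of_not_gt fun hlt => ?_)
    obtain ⟨c, hc1, hc2⟩ := EReal.lt_iff_exists_real_btwn.1 hlt
    have hp := exp_lt_of_neg_inv_mul_log_lt hn (measure_ne_top _ _) hc1
    obtain ⟨Q, h1, h2, h3, h4⟩ := exists_relEnt_le_of_exp_lt P hn hp
    have hγc : γ ≤ ENNReal.ofReal c :=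
      (iInf_le_of_le Q (iInf_le_of_le h1 (iInf_le_of_le h2 (iInf_le_of_le h3 le_rfl)))).trans h4
    have hc0 : 0 ≤ c := by
      have h5 := hp.trans_le prob_le_one
      rw [ENNReal.ofReal_lt_one, Real.exp_lt_one_iff] at h5
      have hn0 : (0 : ℝ) < n := by exact_mod_cast Nat.pos_of_ne_zero hn
      nlinarith
    have h6 : (γ : EReal) ≤ c := by
      have := EReal.coe_ennreal_le_coe_ennreal_iff.2 hγc
      rwa [EReal.coe_ennreal_ofReal, max_eq_left hc0] at this
    exact absurd hc2 (not_lt.2 h6)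
  · obtain ⟨c, hc1, hc2⟩ := EReal.lt_iff_exists_real_btwn.1 ha
    have hc0 : 0 ≤ c := by
      have := (EReal.coe_ennreal_nonneg γ).trans hc1.le
      exact_mod_cast this
    have hγc : γ < ENNReal.ofReal c := by
      rwa [← EReal.coe_ennreal_lt_coe_ennreal_iff, EReal.coe_ennreal_ofReal, max_eq_left hc0]
    simp only [hγ, iInf_lt_iff] at hγc
    obtain ⟨Q, h1, h2, h3, h4⟩ := hγc
    filter_upwards [eventually_exp_le_of_relEnt_lt P Q h2 h3 h4, eventually_ne_atTop 0] with n hn h0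
    exact (neg_inv_mul_log_le h0 (measure_ne_top _ _) hn).trans_lt hc2
end

section
/- Let P be a probability measure on a measurable space 𝒳 and let f : 𝒳 → ℝ be measurable. Define γ(α) := inf{ D(Q‖P) : Q a probability measure on 𝒳 with f Q-integrable and ∫ f dQ = α } and γ*(α) := sup_{λ∈ℝ} ( λα − log ∫ e^{λf} dP ). Then for every α ∈ ℝ, γ(α) = γ*(α) as an equality in [0,+∞]. -/
open MeasureTheory Filter Topology Real
open scoped ENNReal NNReal Classical

/-- One half of the Donsker–Varadhan inequality. -/
lemma integral_sub_log_lintegral_exp_le_relEnt {X : Type*} [MeasurableSpace X]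
    (P Q : Measure X) [IsProbabilityMeasure P] [IsProbabilityMeasure Q] {f : X → ℝ}
    (hf : Measurable f) (hfQ : Integrable f Q) :
    ((∫ x, f x ∂Q : ℝ) : EReal) - ENNReal.log (∫⁻ x, ENNReal.ofReal (exp (f x)) ∂P)
      ≤ (relEnt Q P : EReal) := by
  unfold relEnt
  split_ifs with h
  swap
  · simp
  obtain ⟨hac, hllr⟩ := h
  by_cases htop : ∫⁻ x, ENNReal.ofReal (exp (f x)) ∂P = ⊤
  · simp [htop]
  have hexp : Integrable (fun x ↦ exp (f x)) P :=
    ⟨by fun_prop, (hasFiniteIntegral_iff_ofReal (.of_forall fun x ↦ (exp_pos _).le)).2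
      (lt_top_iff_ne_top.2 htop)⟩
  have hacT : Q ≪ P.tilted f := hac.trans (absolutelyContinuous_tilted hexp)
  have := isProbabilityMeasure_tilted hexp
  have hnonneg := InformationTheory.integral_llr_add_sub_measure_univ_nonneg hacT
    (integrable_llr_tilted_right hac hfQ hllr hexp)
  rw [integral_llr_tilted_right hac hfQ hexp hllr] at hnonneg
  rw [← ofReal_integral_eq_lintegral_ofReal hexp (.of_forall fun x ↦ (exp_pos _).le),
    ENNReal.log_ofReal_of_pos (integral_exp_pos hexp), ← EReal.coe_sub,
    EReal.coe_ennreal_ofReal, EReal.coe_le_coe_iff]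
  simp only [probReal_univ, add_sub_cancel_right] at hnonneg
  exact le_max_of_le_left (by linarith)

/-- Exponentially tilting the restriction of `P` to `A` so that `g` becomes centred costs relative
entropy `-log ∫_A e^{l g} dP`. -/
lemma exists_isProbabilityMeasure_relEnt_eq_neg_log_mgf {X : Type*} [MeasurableSpace X]
    (P : Measure X) [IsProbabilityMeasure P] {g : X → ℝ} (hg : Measurable g) {A : Set X}
    (hA : MeasurableSet A) (hPA : P A ≠ 0) (l : ℝ)
    (hexp : Integrable (fun x ↦ exp (l * g x)) (P.restrict A))
    (hmul : Integrable (fun x ↦ g x * exp (l * g x)) (P.restrict A))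
    (hzero : ∫ x in A, g x * exp (l * g x) ∂P = 0) :
    ∃ Q : Measure X, IsProbabilityMeasure Q ∧ Integrable g Q ∧ ∫ x, g x ∂Q = 0 ∧
      relEnt Q P = ENNReal.ofReal (-log (ProbabilityTheory.mgf g (P.restrict A) l)) := by
  have : NeZero (P.restrict A) := ⟨by simpa using hPA⟩
  have hprob := isProbabilityMeasure_tilted hexp
  have hac : P.restrict A ≪ P := Measure.restrict_le_self.absolutelyContinuous
  set Q := (P.restrict A).tilted (fun x ↦ l * g x) with hQ
  have hQA : Q ≪ P.restrict A := tilted_absolutelyContinuous _ _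
  have hgQ : Integrable g Q := by
    rw [hQ, integrable_tilted_iff hexp]
    exact hmul.congr (.of_forall fun x ↦ mul_comm _ _)
  have hgQ0 : ∫ x, g x ∂Q = 0 := by
    rw [hQ, integral_tilted]
    have : ∀ x, (exp (l * g x) / ∫ y in A, exp (l * g y) ∂P) • g x
        = (∫ y in A, exp (l * g y) ∂P)⁻¹ * (g x * exp (l * g x)) := fun x ↦ by
      rw [smul_eq_mul, div_eq_inv_mul]; ring
    simp_rw [this]
    rw [integral_const_mul, hzero, mul_zero]
  have hllrA : llr (P.restrict A) P =ᵐ[P.restrict A] 0 := by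
    have h1 := hac.ae_le (Measure.rnDeriv_restrict_self P hA)
    filter_upwards [h1, ae_restrict_mem hA] with x hx hxA
    simp [llr, hx, hxA]
  have hllr : llr Q P =ᵐ[Q]
      fun x ↦ l * g x - log (ProbabilityTheory.mgf g (P.restrict A) l) := by
    refine hQA.ae_le ?_
    filter_upwards [llr_tilted_left hac hexp (by fun_prop : AEMeasurable (fun x ↦ l * g x) P),
      hllrA] with x hx hxA
    rw [hx, hxA, Pi.zero_apply, add_zero, ProbabilityTheory.mgf]
  refine ⟨Q, hprob, hgQ, hgQ0, ?_⟩
  have hint : Integrable (fun x ↦ l * g x - log (ProbabilityTheory.mgf g (P.restrict A) l)) Q :=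
    (hgQ.const_mul l).sub (integrable_const _)
  rw [relEnt, if_pos ⟨hQA.trans hac, (integrable_congr hllr).2 hint⟩, integral_congr_ae hllr,
    integral_sub (hgQ.const_mul l) (integrable_const _), integral_const_mul, hgQ0]
  simp

lemma integrable_exp_mul_restrict_abs_le {X : Type*} [MeasurableSpace X] (P : Measure X)
    [IsFiniteMeasure P] {g : X → ℝ} (hg : Measurable g) (r l : ℝ) :
    Integrable (fun x ↦ exp (l * g x)) (P.restrict {x | |g x| ≤ r}) := by
  refine ProbabilityTheory.integrable_exp_mul_of_mem_Icc (a := -r) (b := r) hg.aemeasurable ?_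
  filter_upwards [ae_restrict_mem (measurableSet_le hg.abs measurable_const)] with x hx
  exact abs_le.1 hx

/-- If `g` charges the positive half-line, the sublevel sets of the moment generating functions of
its truncations are eventually uniformly bounded above. -/
lemma exists_forall_mgf_restrict_le_one_imp_le {X : Type*} [MeasurableSpace X] (P : Measure X)
    [IsFiniteMeasure P] {g : X → ℝ} (hg : Measurable g) (hpos : P {x | 0 < g x} ≠ 0) :
    ∃ (N : ℕ) (R : ℝ), ∀ n : ℕ, N ≤ n → ∀ l : ℝ,
      ProbabilityTheory.mgf g (P.restrict {x | |g x| ≤ n}) l ≤ 1 → l ≤ R := by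
  have hU : {x | 0 < g x} ⊆ ⋃ k : ℕ, {x | 1 / ((k : ℝ) + 1) ≤ g x ∧ g x ≤ k} := by
    intro x hx
    obtain ⟨a, ha⟩ := exists_nat_one_div_lt (show 0 < g x from hx)
    obtain ⟨b, hb⟩ := exists_nat_ge (g x)
    refine Set.mem_iUnion.2 ⟨max a b, ?_, ?_⟩
    · refine le_trans ?_ ha.le
      gcongr
      exact le_max_left a b
    · exact hb.trans (by exact_mod_cast le_max_right a b)
  obtain ⟨k, hk⟩ := exists_measure_pos_of_not_measure_iUnion_null
    (fun h ↦ hpos (measure_mono_null hU h))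
  set δ : ℝ := 1 / ((k : ℝ) + 1) with hδ
  have hδ0 : 0 < δ := by positivity
  set p : ℝ := P.real {x | δ ≤ g x ∧ g x ≤ k} with hp
  have hp0 : 0 < p := ENNReal.toReal_pos hk.ne' (measure_ne_top _ _)
  refine ⟨k, max 0 (-log p / δ), fun n hn l hl ↦ ?_⟩
  rcases le_total l 0 with h0 | h0
  · exact le_max_of_le_left h0
  refine le_max_of_le_right ?_
  have hn' : (k : ℝ) ≤ n := by exact_mod_cast hn
  have h1 : p ≤ (P.restrict {x | |g x| ≤ n}).real {x | δ ≤ g x} := by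
    rw [measureReal_restrict_apply (measurableSet_le measurable_const hg)]
    refine measureReal_mono (fun x hx ↦ ⟨hx.1, abs_le.2 ⟨?_, hx.2.trans hn'⟩⟩)
    have := hx.1
    linarith [(Nat.cast_nonneg n : (0 : ℝ) ≤ n)]
  have h2 := ProbabilityTheory.measure_ge_le_exp_mul_mgf (X := g) δ h0
    (integrable_exp_mul_restrict_abs_le P hg n l)
  have h3 : p ≤ exp (-l * δ) :=
    (h1.trans h2).trans (mul_le_of_le_one_right (exp_pos _).le hl)
  have h4 := (log_le_iff_le_exp hp0).2 h3
  rw [le_div_iff₀ hδ0]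
  linarith

/-- Duality when `g` takes values on both sides of `0` with positive probability. -/
lemma exists_lintegral_exp_mul_le_of_measure_pos_of_measure_neg {X : Type*} [MeasurableSpace X]
    (P : Measure X) [IsProbabilityMeasure P] {g : X → ℝ} (hg : Measurable g) {c : ℝ}
    (hc : ∀ Q : Measure X, IsProbabilityMeasure Q → Integrable g Q → ∫ x, g x ∂Q = 0 →
      ENNReal.ofReal c < relEnt Q P)
    (hpos : P {x | 0 < g x} ≠ 0) (hneg : P {x | g x < 0} ≠ 0) :
    ∃ l : ℝ, ∫⁻ x, ENNReal.ofReal (exp (l * g x)) ∂P ≤ ENNReal.ofReal (exp (-c)) := by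
  let A : ℕ → Set X := fun n ↦ {x | |g x| ≤ n}
  have hA : ∀ n, MeasurableSet (A n) := fun n ↦ measurableSet_le hg.abs measurable_const
  have hAmono : Monotone A := fun m n hmn x hx ↦
    le_trans (show |g x| ≤ m from hx) (by exact_mod_cast hmn)
  let Z : ℕ → ℝ → ℝ := fun n ↦ ProbabilityTheory.mgf g (P.restrict (A n))
  have hint : ∀ n l, Integrable (fun x ↦ exp (l * g x)) (P.restrict (A n)) :=
    fun n l ↦ integrable_exp_mul_restrict_abs_le P hg n l
  have hcont : ∀ n, Continuous (Z n) := fun n ↦ ProbabilityTheory.continuous_mgf (hint n)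
  have hZ0 : ∀ n, Z n 0 ≤ 1 := fun n ↦ by
    simp only [Z, ProbabilityTheory.mgf_zero', measureReal_restrict_apply_univ]
    exact measureReal_le_one
  have hZmono : ∀ l, Monotone fun n ↦ Z n l := fun l m n hmn ↦
    integral_mono_measure (Measure.restrict_mono (hAmono hmn) le_rfl)
      (.of_forall fun x ↦ (exp_pos _).le) (hint n l)
  obtain ⟨N₁, R₁, h₁⟩ := exists_forall_mgf_restrict_le_one_imp_le P hg hpos
  obtain ⟨N₂, R₂, h₂⟩ := exists_forall_mgf_restrict_le_one_imp_le P hg.neg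
    (by simpa using hneg)
  set N := max N₁ N₂
  have hbdd : ∀ n, N ≤ n → ∀ l, Z n l ≤ 1 → l ∈ Set.Icc (-R₂) R₁ := by
    intro n hn l hl
    refine ⟨?_, h₁ n ((le_max_left _ _).trans hn) l hl⟩
    have := h₂ n ((le_max_right _ _).trans hn) (-l)
      (by simpa [ProbabilityTheory.mgf_neg, Z, A] using hl)
    linarith
  have hmin : ∀ n, N ≤ n → ∃ l, ∀ y, Z n l ≤ Z n y := by
    intro n hn
    refine (hcont n).exists_forall_le' 0 ?_
    filter_upwards [(isCompact_Icc (a := -R₂) (b := R₁)).compl_mem_cocompact] with l hl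
    by_contra! h
    exact hl (hbdd n hn l (h.le.trans (hZ0 n)))
  have hsmall : ∀ n, N ≤ n → ∃ l ∈ Set.Icc (-R₂) R₁, Z n l ≤ exp (-c) := by
    intro n hn
    obtain ⟨l, hl⟩ := hmin n hn
    have hlI := hbdd n hn l ((hl 0).trans (hZ0 n))
    refine ⟨l, hlI, ?_⟩
    by_cases hPA : P (A n) = 0
    · have : P.restrict (A n) = 0 := by simpa using hPA
      simp only [Z, this, ProbabilityTheory.mgf_zero_measure]
      exact (exp_pos _).le
    have hl_int : l ∈ interior (ProbabilityTheory.integrableExpSet g (P.restrict (A n))) := by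
      have : ProbabilityTheory.integrableExpSet g (P.restrict (A n)) = Set.univ :=
        Set.eq_univ_of_forall (hint n)
      simp [this]
    have hder := ProbabilityTheory.hasDerivAt_mgf hl_int
    have hzero := IsLocalMin.hasDerivAt_eq_zero (f := Z n) (.of_forall hl) hder
    have hmul := ProbabilityTheory.integrable_pow_mul_exp_of_mem_interior_integrableExpSet
      hl_int 1
    simp only [pow_one] at hmul
    obtain ⟨Q, hQ, hgQ, hgQ0, hQe⟩ := exists_isProbabilityMeasure_relEnt_eq_neg_log_mgf P hg
      (hA n) hPA l (hint n l) hmul hzero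
    have hlt := hc Q hQ hgQ hgQ0
    rw [hQe] at hlt
    have hlt' := (ENNReal.ofReal_lt_ofReal_iff'.1 hlt).1
    have hZpos : 0 < Z n l := by
      have : NeZero (P.restrict (A n)) := ⟨by simpa using hPA⟩
      exact integral_exp_pos (hint n l)
    rw [← log_le_iff_le_exp hZpos]
    simp only [Z]
    linarith
  choose! u hu huc using fun n (hn : N ≤ n) ↦ hsmall n hn
  obtain ⟨l, -, φ, hφ, hlim⟩ := (isCompact_Icc (a := -R₂) (b := R₁)).tendsto_subseq
    (x := fun k ↦ u (N + k)) (fun k ↦ hu _ (Nat.le_add_right _ _))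
  refine ⟨l, ?_⟩
  have hZl : ∀ m, Z m l ≤ exp (-c) := by
    intro m
    refine le_of_tendsto (((hcont m).tendsto l).comp hlim) ?_
    filter_upwards [eventually_ge_atTop m] with k hk
    refine (hZmono _ ?_).trans (huc (N + φ k) (Nat.le_add_right _ _))
    exact (hk.trans (hφ.id_le k)).trans (Nat.le_add_left _ _)
  have hU : ⋃ n, A n = Set.univ := Set.eq_univ_of_forall fun x ↦
    Set.mem_iUnion.2 (exists_nat_ge |g x|)
  rw [← setLIntegral_univ, ← hU, setLIntegral_iUnion_of_directed _ hAmono.directed_le]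
  refine iSup_le fun m ↦ ?_
  rw [← ofReal_integral_eq_lintegral_ofReal (hint m l) (.of_forall fun x ↦ (exp_pos _).le)]
  exact ENNReal.ofReal_le_ofReal (hZl m)

/-- Duality when `g` is almost surely nonpositive. -/
lemma exists_lintegral_exp_mul_le_of_measure_pos_eq_zero {X : Type*} [MeasurableSpace X]
    (P : Measure X) [IsProbabilityMeasure P] {g : X → ℝ} (hg : Measurable g) {c : ℝ}
    (hc : ∀ Q : Measure X, IsProbabilityMeasure Q → Integrable g Q → ∫ x, g x ∂Q = 0 →
      ENNReal.ofReal c < relEnt Q P)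
    (hpos : P {x | 0 < g x} = 0) :
    ∃ l : ℝ, ∫⁻ x, ENNReal.ofReal (exp (l * g x)) ∂P ≤ ENNReal.ofReal (exp (-c)) := by
  have hA : MeasurableSet {x | g x = 0} := hg (measurableSet_singleton 0)
  have hgle : ∀ᵐ x ∂P, g x ≤ 0 := by simpa [ae_iff] using hpos
  have hlim : Tendsto (fun n : ℕ ↦ ∫⁻ x, ENNReal.ofReal (exp (n * g x)) ∂P) atTop
      (𝓝 (∫⁻ x, Set.indicator {x | g x = 0} 1 x ∂P)) := by
    refine tendsto_lintegral_of_dominated_convergence (fun _ ↦ 1) (fun n ↦ by fun_prop)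
      (fun n ↦ ?_) (by simp) ?_
    · filter_upwards [hgle] with x hx
      rw [ENNReal.ofReal_le_one, exp_le_one_iff]
      exact mul_nonpos_of_nonneg_of_nonpos n.cast_nonneg hx
    · filter_upwards [hgle] with x hx
      rcases hx.lt_or_eq with h | h
      · rw [Set.indicator_of_notMem (by simpa using h.ne), ← ENNReal.ofReal_zero]
        exact ENNReal.tendsto_ofReal
          (tendsto_exp_atBot.comp (tendsto_natCast_atTop_atTop.atTop_mul_const_of_neg h))
      · simp [h]
  rw [lintegral_indicator_one hA] at hlim
  have hlt : P {x | g x = 0} < ENNReal.ofReal (exp (-c)) := by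
    by_cases hPA : P {x | g x = 0} = 0
    · rw [hPA]
      exact ENNReal.ofReal_pos.2 (exp_pos _)
    have hae : ∀ᵐ x ∂P.restrict {x | g x = 0}, g x * exp (0 * g x) = 0 := by
      filter_upwards [ae_restrict_mem hA] with x hx
      rw [show g x = 0 from hx, zero_mul]
    obtain ⟨Q, hQ, hgQ, hgQ0, hQe⟩ := exists_isProbabilityMeasure_relEnt_eq_neg_log_mgf P hg
      hA hPA 0 (by simp) ((integrable_zero _ _ _).congr (hae.mono fun x hx ↦ hx.symm))
      (integral_eq_zero_of_ae hae)
    have hlt := hc Q hQ hgQ hgQ0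
    rw [hQe, ProbabilityTheory.mgf_zero', measureReal_restrict_apply_univ] at hlt
    have hlt' := (ENNReal.ofReal_lt_ofReal_iff'.1 hlt).1
    have hp : 0 < P.real {x | g x = 0} := ENNReal.toReal_pos hPA (measure_ne_top _ _)
    rw [← ofReal_measureReal, ENNReal.ofReal_lt_ofReal_iff (exp_pos _), ← log_lt_iff_lt_exp hp]
    linarith
  obtain ⟨n, hn⟩ := (hlim.eventually_lt_const hlt).exists
  exact ⟨n, hn.le⟩

/-- If every centring of `g` costs relative entropy more than `c`, then some exponential moment of
`g` is at most `e^{-c}`. -/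
lemma exists_lintegral_exp_mul_le {X : Type*} [MeasurableSpace X]
    (P : Measure X) [IsProbabilityMeasure P] {g : X → ℝ} (hg : Measurable g) {c : ℝ}
    (hc : ∀ Q : Measure X, IsProbabilityMeasure Q → Integrable g Q → ∫ x, g x ∂Q = 0 →
      ENNReal.ofReal c < relEnt Q P) :
    ∃ l : ℝ, ∫⁻ x, ENNReal.ofReal (exp (l * g x)) ∂P ≤ ENNReal.ofReal (exp (-c)) := by
  by_cases hpos : P {x | 0 < g x} = 0
  · exact exists_lintegral_exp_mul_le_of_measure_pos_eq_zero P hg hc hpos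
  by_cases hneg : P {x | g x < 0} = 0
  · obtain ⟨l, hl⟩ := exists_lintegral_exp_mul_le_of_measure_pos_eq_zero (c := c) P hg.neg
      (fun Q hQ hgQ hgQ0 ↦ hc Q hQ (by simpa using hgQ.neg)
        (by simpa [integral_neg] using hgQ0)) (by simpa using hneg)
    exact ⟨-l, by simpa using hl⟩
  · exact exists_lintegral_exp_mul_le_of_measure_pos_of_measure_neg P hg hc hpos hneg

/-- **Duality for the I-projection (equality constraint).**
`inf { D(Q‖P) : ∫ f dQ = α } = sup_{λ ∈ ℝ} (λ α - log ∫ e^{λ f} dP)`. -/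
theorem iProjection_duality_eq {X : Type*} [MeasurableSpace X]
    (P : Measure X) [IsProbabilityMeasure P] (f : X → ℝ) (hf : Measurable f) (α : ℝ) :
    ((⨅ (Q : Measure X) (_ : IsProbabilityMeasure Q) (_ : Integrable f Q)
        (_ : ∫ x, f x ∂Q = α), relEnt Q P : ℝ≥0∞) : EReal)
      = ⨆ l : ℝ, ((l * α : ℝ) : EReal)
          - ENNReal.log (∫⁻ x, ENNReal.ofReal (Real.exp (l * f x)) ∂P) := by
  apply le_antisymm
  · refine le_of_forall_lt fun a ha ↦ ?_
    obtain ⟨c, hac, hc⟩ := EReal.lt_iff_exists_real_btwn.1 ha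
    refine hac.trans_le ?_
    rcases lt_or_ge c 0 with hc0 | hc0
    · refine le_iSup_of_le 0 ?_
      simpa using hc0.le
    have hc' : ∀ Q : Measure X, IsProbabilityMeasure Q → Integrable (fun x ↦ f x - α) Q →
        ∫ x, (f x - α) ∂Q = 0 → ENNReal.ofReal c < relEnt Q P := by
      intro Q hQ hgQ hgQ0
      have hfQ : Integrable f Q := by
        simpa only [Pi.add_def, sub_add_cancel] using hgQ.add (integrable_const α)
      rw [integral_sub hfQ (integrable_const _), integral_const, probReal_univ, one_smul,
        sub_eq_zero] at hgQ0
      rw [← EReal.coe_ennreal_lt_coe_ennreal_iff, EReal.coe_ennreal_ofReal, max_eq_left hc0]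
      refine hc.trans_le (EReal.coe_ennreal_le_coe_ennreal_iff.2 ?_)
      exact iInf_le_of_le Q <| iInf_le_of_le hQ <| iInf_le_of_le hfQ <| iInf_le _ hgQ0
    obtain ⟨l, hl⟩ := exists_lintegral_exp_mul_le P (hf.sub_const α) hc'
    refine le_iSup_of_le l ?_
    have hle : ∫⁻ x, ENNReal.ofReal (exp (l * f x)) ∂P ≤ ENNReal.ofReal (exp (l * α - c)) := by
      have : ∀ x, ENNReal.ofReal (exp (l * f x))
          = ENNReal.ofReal (exp (l * α)) * ENNReal.ofReal (exp (l * (f x - α))) := fun x ↦ by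
        rw [← ENNReal.ofReal_mul (exp_pos _).le, ← exp_add]; ring_nf
      simp_rw [this]
      rw [lintegral_const_mul _ (by fun_prop), sub_eq_add_neg, exp_add,
        ENNReal.ofReal_mul (exp_pos _).le]
      gcongr
    have hlog := ENNReal.log_le_log hle
    rw [ENNReal.log_ofReal_of_pos (exp_pos _), log_exp] at hlog
    calc (c : EReal) = ((l * α : ℝ) : EReal) - ((l * α - c : ℝ) : EReal) := by
          rw [← EReal.coe_sub]; simp
      _ ≤ _ := EReal.sub_le_sub le_rfl hlog
  · refine iSup_le fun l ↦ ?_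
    have hbound : ∀ Q : Measure X, IsProbabilityMeasure Q → Integrable f Q → ∫ x, f x ∂Q = α →
        ((l * α : ℝ) : EReal) - ENNReal.log (∫⁻ x, ENNReal.ofReal (exp (l * f x)) ∂P)
          ≤ relEnt Q P := by
      intro Q hQ hfQ hα
      have := integral_sub_log_lintegral_exp_le_relEnt P Q (hf.const_mul l) (hfQ.const_mul l)
      rwa [integral_const_mul, hα] at this
    have htoENNReal : (((l * α : ℝ) : EReal)
        - ENNReal.log (∫⁻ x, ENNReal.ofReal (exp (l * f x)) ∂P)).toENNReal
        ≤ ⨅ (Q : Measure X) (_ : IsProbabilityMeasure Q) (_ : Integrable f Q)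
          (_ : ∫ x, f x ∂Q = α), relEnt Q P :=
      le_iInf fun Q ↦ le_iInf fun hQ ↦ le_iInf fun hfQ ↦ le_iInf fun hα ↦ by
        simpa using EReal.toENNReal_le_toENNReal (hbound Q hQ hfQ hα)
    refine le_trans ?_ (EReal.coe_ennreal_le_coe_ennreal_iff.2 htoENNReal)
    exact EReal.coe_toENNReal_eq_max ▸ le_max_right _ _
end

section
/- Let P be a probability measure on a measurable space 𝒳 and let f : 𝒳 → ℝ be measurable. Define γ_+(α) := inf{ D(Q‖P) : Q a probability measure on 𝒳 with f Q-integrable and ∫ f dQ ≥ α } and γ_+*(α) := sup_{λ≥0} ( λα − log ∫ e^{λf} dP ). Then for every α ∈ ℝ, γ_+(α) = γ_+*(α) as an equality in [0,+∞]. -/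
open MeasureTheory Filter Topology Real
open scoped ENNReal NNReal Classical

/-- The variational lower bound of Donsker and Varadhan for half-space constraints. -/
lemma neg_log_lintegral_exp_le_relEnt {X : Type*} [MeasurableSpace X]
    (P Q : Measure X) [IsProbabilityMeasure P] [IsProbabilityMeasure Q] {g : X → ℝ}
    (hg : Measurable g) (hgQ : Integrable g Q) (hQ : 0 ≤ ∫ x, g x ∂Q) {l : ℝ} (hl : 0 ≤ l) :
    -ENNReal.log (∫⁻ x, ENNReal.ofReal (Real.exp (l * g x)) ∂P) ≤ (relEnt Q P : EReal) := by
  unfold relEnt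
  split_ifs with h
  · obtain ⟨hac, hint⟩ := h
    by_cases hexp : Integrable (fun x ↦ Real.exp (l * g x)) P
    · have hP := isProbabilityMeasure_tilted hexp
      have hac' : Q ≪ P.tilted (fun x ↦ l * g x) :=
        hac.trans (absolutelyContinuous_tilted hexp)
      have hnn := InformationTheory.integral_llr_add_sub_measure_univ_nonneg hac'
        (integrable_llr_tilted_right hac (hgQ.const_mul l) hint hexp)
      rw [integral_llr_tilted_right hac (hgQ.const_mul l) hexp hint, integral_const_mul] at hnn
      simp only [probReal_univ] at hnn
      have hmul := mul_nonneg hl hQ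
      rw [← ofReal_integral_eq_lintegral_ofReal hexp (ae_of_all _ fun _ ↦ (Real.exp_pos _).le),
        ENNReal.log_ofReal_of_pos (integral_exp_pos hexp), EReal.coe_ennreal_ofReal,
        ← EReal.coe_neg, EReal.coe_le_coe_iff]
      exact le_max_of_le_left (by linarith)
    · have htop : ∫⁻ x, ENNReal.ofReal (Real.exp (l * g x)) ∂P = ⊤ := by
        by_contra hne
        refine hexp ⟨by fun_prop, ?_⟩
        rw [hasFiniteIntegral_iff_ofReal (ae_of_all _ fun _ ↦ (Real.exp_pos _).le)]
        exact lt_top_iff_ne_top.2 hne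
      simp [htop]
  · simp

/-- Tilting `P` restricted to a set where `g` is bounded gives an explicit entropy bound. -/
lemma exists_relEnt_le_neg_log_mgf {X : Type*} [MeasurableSpace X]
    (P : Measure X) [IsProbabilityMeasure P] {g : X → ℝ} (hg : Measurable g)
    {A : Set X} (hA : MeasurableSet A) (hPA : P A ≠ 0) {B : ℝ} (hB : ∀ x ∈ A, |g x| ≤ B) {l : ℝ}
    (hd : 0 ≤ ∫ x in A, g x * Real.exp (l * g x) ∂P)
    (hld : l * ∫ x in A, g x * Real.exp (l * g x) ∂P ≤ 0) :
    ∃ Q : Measure X, IsProbabilityMeasure Q ∧ Integrable g Q ∧ 0 ≤ ∫ x, g x ∂Q ∧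
      relEnt Q P ≤ ENNReal.ofReal (-Real.log (ProbabilityTheory.mgf g (P.restrict A) l)) := by
  set μ := P.restrict A with hμ
  have : NeZero μ := ⟨by rwa [hμ, Ne, Measure.restrict_eq_zero]⟩
  have hμB : ∀ᵐ x ∂μ, g x ∈ Set.Icc (-B) B := by
    filter_upwards [ae_restrict_mem hA] with x hx using abs_le.1 (hB x hx)
  have hexp : Integrable (fun x ↦ Real.exp (l * g x)) μ :=
    ProbabilityTheory.integrable_exp_mul_of_mem_Icc hg.aemeasurable hμB
  have hQ := isProbabilityMeasure_tilted hexp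
  have hQμ : μ.tilted (fun x ↦ l * g x) ≪ μ := tilted_absolutelyContinuous _ _
  have hμP : μ ≪ P := Measure.restrict_le_self.absolutelyContinuous
  have hZ : 0 < ∫ x, Real.exp (l * g x) ∂μ := integral_exp_pos hexp
  have hgQ : Integrable g (μ.tilted (fun x ↦ l * g x)) :=
    Integrable.of_mem_Icc (-B) B hg.aemeasurable (hQμ hμB)
  have hmean : ∫ x, g x ∂(μ.tilted (fun x ↦ l * g x))
      = (∫ x, g x * Real.exp (l * g x) ∂μ) / ∫ x, Real.exp (l * g x) ∂μ := by
    rw [integral_tilted, ← integral_div]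
    refine integral_congr_ae (ae_of_all _ fun x ↦ ?_)
    simp only [smul_eq_mul]
    ring
  have hllrμ : llr μ P =ᵐ[μ] 0 := by
    filter_upwards [hμP.ae_eq (Measure.rnDeriv_restrict_self P hA), ae_restrict_mem hA]
      with x hx hxA
    simp only [hμ, llr, hx, Set.indicator_of_mem hxA, Pi.one_apply, ENNReal.toReal_one,
      Real.log_one, Pi.zero_apply]
  have hllr : llr (μ.tilted (fun x ↦ l * g x)) P =ᵐ[μ.tilted (fun x ↦ l * g x)]
      fun x ↦ l * g x - Real.log (∫ x, Real.exp (l * g x) ∂μ) := by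
    refine hQμ.ae_eq ?_
    filter_upwards [llr_tilted_left hμP hexp (hg.const_mul l).aemeasurable, hllrμ] with x hx hx0
    rw [hx, hx0, Pi.zero_apply, add_zero]
  have hint : Integrable (llr (μ.tilted (fun x ↦ l * g x)) P) (μ.tilted (fun x ↦ l * g x)) :=
    (integrable_congr hllr).2 ((hgQ.const_mul l).sub (integrable_const _))
  refine ⟨_, hQ, hgQ, hmean ▸ div_nonneg hd hZ.le, ?_⟩
  rw [relEnt, if_pos ⟨hQμ.trans hμP, hint⟩, integral_congr_ae hllr,
    integral_sub (hgQ.const_mul l) (integrable_const _), integral_const_mul, hmean]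
  refine ENNReal.ofReal_le_ofReal ?_
  have := div_nonpos_of_nonpos_of_nonneg hld hZ.le
  rw [mul_div_assoc] at this
  simpa [ProbabilityTheory.mgf] using this

/-- First-order optimality conditions at a minimum over the half line. -/
lemma IsMinOn.hasDerivAt_Ici {φ : ℝ → ℝ} {l d : ℝ} (hl : 0 ≤ l) (hmin : IsMinOn φ (Set.Ici 0) l)
    (hφ : HasDerivAt φ d l) : 0 ≤ d ∧ l * d ≤ 0 := by
  have key : ∀ y : ℝ, 0 ≤ y → 0 ≤ (y - l) * d := fun y hy ↦ by
    have hy' : y - l ∈ posTangentConeAt (Set.Ici (0 : ℝ)) l :=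
      sub_mem_posTangentConeAt_of_segment_subset ((convex_Ici 0).segment_subset hl hy)
    simpa using hmin.localize.hasFDerivWithinAt_nonneg hφ.hasFDerivAt.hasFDerivWithinAt hy'
  constructor
  · simpa using key (l + 1) (by linarith)
  · linarith [key 0 le_rfl]

/-- As `l → ∞`, the exponential integrals of a nonpositive function detect its zero set. -/
lemma neg_log_measure_zero_le_iSup {X : Type*} [MeasurableSpace X]
    (P : Measure X) [IsProbabilityMeasure P] {g : X → ℝ} (hg : Measurable g)
    (hpos : P {x | 0 < g x} = 0) :
    -ENNReal.log (P {x | g x = 0}) ≤ ⨆ (l : ℝ) (_ : 0 ≤ l),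
      -ENNReal.log (∫⁻ x, ENNReal.ofReal (Real.exp (l * g x)) ∂P) := by
  have hA : MeasurableSet {x | g x = 0} := hg (measurableSet_singleton 0)
  have hle : ∀ᵐ x ∂P, g x ≤ 0 := by
    rw [ae_iff]
    simpa using hpos
  have hlim : Tendsto (fun n : ℕ ↦ ∫⁻ x, ENNReal.ofReal (Real.exp (n * g x)) ∂P) atTop
      (𝓝 (P {x | g x = 0})) := by
    rw [← lintegral_indicator_one hA]
    refine tendsto_lintegral_of_dominated_convergence (fun _ ↦ 1) (fun n ↦ by fun_prop) ?_
      (by simp) ?_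
    · intro n
      filter_upwards [hle] with x hx
      rw [ENNReal.ofReal_le_one, Real.exp_le_one_iff]
      exact mul_nonpos_of_nonneg_of_nonpos n.cast_nonneg hx
    · filter_upwards [hle] with x hx
      rcases hx.lt_or_eq with hx | hx
      · rw [Set.indicator_of_notMem (by simpa using hx.ne)]
        rw [← ENNReal.ofReal_zero]
        exact ENNReal.tendsto_ofReal (Real.tendsto_exp_atBot.comp
          (tendsto_natCast_atTop_atTop.atTop_mul_const_of_neg hx))
      · simp [hx]
  refine le_of_tendsto' (((ENNReal.continuous_log.neg).tendsto _).comp hlim) fun n ↦ ?_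
  exact le_iSup₂_of_le (n : ℝ) n.cast_nonneg le_rfl

/-- If `g` is positive with positive probability and every measure with nonnegative mean of `g` has
entropy above `c > 0`, some exponential integral of `g` is at most `exp (-c)`. -/
lemma exists_lintegral_exp_le {X : Type*} [MeasurableSpace X]
    (P : Measure X) [IsProbabilityMeasure P] {g : X → ℝ} (hg : Measurable g)
    (hpos : P {x | 0 < g x} ≠ 0) {c : ℝ} (hc : 0 < c)
    (hQ : ∀ Q : Measure X, IsProbabilityMeasure Q → Integrable g Q → 0 ≤ ∫ x, g x ∂Q →
      ENNReal.ofReal c < relEnt Q P) :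
    ∃ l : ℝ, 0 ≤ l ∧
      ∫⁻ x, ENNReal.ofReal (Real.exp (l * g x)) ∂P ≤ ENNReal.ofReal (Real.exp (-c)) := by
  obtain ⟨N, hN⟩ : ∃ N : ℕ, P {x | |g x| ≤ N ∧ 1 / ((N : ℝ) + 1) ≤ g x} ≠ 0 := by
    by_contra! h
    refine hpos (measure_mono_null (fun x hx ↦ ?_) (measure_iUnion_null h))
    obtain ⟨n, hn⟩ := exists_nat_ge |g x|
    obtain ⟨m, hm⟩ := exists_nat_one_div_lt (show 0 < g x from hx)
    refine Set.mem_iUnion.2 ⟨max n m, hn.trans (by simp), le_trans ?_ hm.le⟩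
    exact one_div_le_one_div_of_le (by positivity) (by simp)
  set δ : ℝ := 1 / ((N : ℝ) + 1) with hδ
  have hδ0 : 0 < δ := by positivity
  set A : ℕ → Set X := fun n ↦ {x | |g x| ≤ ((N + n : ℕ) : ℝ)} with hAdef
  have hA : ∀ n, MeasurableSet (A n) := fun n ↦ measurableSet_le (by fun_prop) measurable_const
  have hAmono : Monotone A := fun m n hmn x hx ↦
    le_trans (show |g x| ≤ _ from hx) (by exact_mod_cast Nat.add_le_add_left hmn N)
  have hAuniv : ⋃ n, A n = Set.univ := Set.eq_univ_of_forall fun x ↦ by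
    obtain ⟨n, hn⟩ := exists_nat_ge |g x|
    exact Set.mem_iUnion.2 ⟨n, hn.trans (by simp)⟩
  have hexp : ∀ n l, Integrable (fun x ↦ Real.exp (l * g x)) (P.restrict (A n)) := fun n l ↦ by
    refine ProbabilityTheory.integrable_exp_mul_of_mem_Icc (a := -((N + n : ℕ) : ℝ))
      (b := ((N + n : ℕ) : ℝ)) hg.aemeasurable ?_
    filter_upwards [ae_restrict_mem (hA n)] with x hx using abs_le.1 hx
  set φ : ℕ → ℝ → ℝ := fun n ↦ ProbabilityTheory.mgf g (P.restrict (A n)) with hφ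
  have hderiv : ∀ n l, HasDerivAt (φ n) (∫ x in A n, g x * Real.exp (l * g x) ∂P) l := fun n l ↦ by
    refine ProbabilityTheory.hasDerivAt_mgf ?_
    have : ProbabilityTheory.integrableExpSet g (P.restrict (A n)) = Set.univ :=
      Set.eq_univ_of_forall (hexp n)
    simp [this]
  have hcont : ∀ n, Continuous (φ n) := fun n ↦
    continuous_iff_continuousAt.2 fun l ↦ (hderiv n l).continuousAt
  have hφmono : ∀ l, Monotone fun n ↦ φ n l := fun l m n hmn ↦
    setIntegral_mono_set (hexp n l) (ae_of_all _ fun _ ↦ (Real.exp_pos _).le)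
      (hAmono hmn).eventuallyLE
  set p : ℝ := (P.restrict (A 0)).real {x | δ ≤ g x} with hp
  have hp0 : 0 < p := by
    rw [hp, measureReal_restrict_apply (measurableSet_le measurable_const hg),
      measureReal_def, ENNReal.toReal_pos_iff]
    refine ⟨pos_iff_ne_zero.2 ?_, measure_lt_top _ _⟩
    convert hN using 3
    ext x
    simp [hAdef, and_comm]
  have hbound : ∀ n l, 0 ≤ l → φ n l ≤ 1 → l ≤ p⁻¹ / δ := fun n l hl h ↦ by
    have h1 : p ≤ Real.exp (-l * δ) * φ 0 l :=
      ProbabilityTheory.measure_ge_le_exp_mul_mgf δ hl (hexp 0 l)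
    have h2 : φ 0 l ≤ 1 := (hφmono l n.zero_le).trans h
    have h3 : p ≤ Real.exp (-l * δ) :=
      h1.trans (mul_le_of_le_one_right (Real.exp_pos _).le h2)
    rw [neg_mul, Real.exp_neg, le_inv_comm₀ hp0 (Real.exp_pos _)] at h3
    rw [le_div_iff₀ hδ0]
    linarith [Real.add_one_le_exp (l * δ)]
  have hφ0 : ∀ n, φ n 0 ≤ 1 := fun n ↦ by
    simp only [hφ, ProbabilityTheory.mgf_zero', measureReal_restrict_apply_univ]
    exact measureReal_le_one
  have hPA : ∀ n, P (A n) ≠ 0 := fun n h0 ↦ by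
    refine hN (measure_mono_null (fun x hx ↦ ?_) h0)
    exact hAmono n.zero_le (by simpa [hAdef] using hx.1)
  set S : ℕ → Set ℝ := fun n ↦ Set.Ici 0 ∩ {l | φ n l ≤ Real.exp (-c)} with hS
  have hSclosed : ∀ n, IsClosed (S n) := fun n ↦
    isClosed_Ici.inter (isClosed_le (hcont n) continuous_const)
  have hSne : ∀ n, (S n).Nonempty := fun n ↦ by
    obtain ⟨l, hl, hmin⟩ := (hcont n).continuousOn.exists_isMinOn' isClosed_Ici
      (Set.mem_Ici.2 le_rfl : (0 : ℝ) ∈ Set.Ici 0) (by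
        rw [eventually_inf_principal]
        filter_upwards [(isCompact_Icc (a := (0 : ℝ)) (b := p⁻¹ / δ)).compl_mem_cocompact]
          with l hl hl0
        by_contra! hlt
        exact hl ⟨hl0, hbound n l hl0 (hlt.le.trans (hφ0 n))⟩)
    obtain ⟨hd, hld⟩ := hmin.hasDerivAt_Ici hl (hderiv n l)
    obtain ⟨Q, hQp, hgQ, hmean, hent⟩ :=
      exists_relEnt_le_neg_log_mgf P hg (hA n) (hPA n) (fun x hx ↦ hx) hd hld
    have hlt := (hQ Q hQp hgQ hmean).trans_le hent
    rw [ENNReal.ofReal_lt_ofReal_iff'] at hlt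
    have : NeZero (P.restrict (A n)) := ⟨by rw [Ne, Measure.restrict_eq_zero]; exact hPA n⟩
    have hφpos : 0 < φ n l := integral_exp_pos (hexp n l)
    exact ⟨l, hl, (Real.log_le_iff_le_exp hφpos).1 (by linarith [hlt.1])⟩
  have hScompact : IsCompact (S 0) :=
    isCompact_Icc.of_isClosed_subset (hSclosed 0) fun l hl ↦
      ⟨hl.1, hbound 0 l hl.1 (le_trans hl.2 (Real.exp_le_one_iff.2 (by linarith)))⟩
  obtain ⟨l, hl⟩ := IsCompact.nonempty_iInter_of_sequence_nonempty_isCompact_isClosed S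
    (fun n l hl ↦ ⟨hl.1, (hφmono l n.le_succ).trans hl.2⟩) hSne hScompact hSclosed
  rw [Set.mem_iInter] at hl
  refine ⟨l, (hl 0).1, ?_⟩
  rw [← setLIntegral_univ, ← hAuniv, setLIntegral_iUnion_of_directed _ hAmono.directed_le]
  refine iSup_le fun n ↦ ?_
  rw [← ofReal_integral_eq_lintegral_ofReal (hexp n l) (ae_of_all _ fun _ ↦ (Real.exp_pos _).le)]
  exact ENNReal.ofReal_le_ofReal (hl n).2

/-- The duality formula for the constraint `0 ≤ ∫ g dQ`. -/
lemma iInf_relEnt_eq_iSup_neg_log {X : Type*} [MeasurableSpace X]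
    (P : Measure X) [IsProbabilityMeasure P] {g : X → ℝ} (hg : Measurable g) :
    ((⨅ (Q : Measure X) (_ : IsProbabilityMeasure Q) (_ : Integrable g Q)
        (_ : 0 ≤ ∫ x, g x ∂Q), relEnt Q P : ℝ≥0∞) : EReal)
      = ⨆ (l : ℝ) (_ : 0 ≤ l),
          -ENNReal.log (∫⁻ x, ENNReal.ofReal (Real.exp (l * g x)) ∂P) := by
  have hle : ∀ Q : Measure X, IsProbabilityMeasure Q → Integrable g Q → 0 ≤ ∫ x, g x ∂Q →
      (⨅ (Q : Measure X) (_ : IsProbabilityMeasure Q) (_ : Integrable g Q)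
        (_ : 0 ≤ ∫ x, g x ∂Q), relEnt Q P) ≤ relEnt Q P :=
    fun Q h1 h2 h3 ↦ iInf_le_of_le Q (iInf_le_of_le h1 (iInf_le_of_le h2 (iInf_le_of_le h3 le_rfl)))
  apply le_antisymm
  · by_cases hpos : P {x | 0 < g x} = 0
    · refine le_trans ?_ (neg_log_measure_zero_le_iSup P hg hpos)
      by_cases h0 : P {x | g x = 0} = 0
      · simp [h0]
      · have hA : MeasurableSet {x | g x = 0} := hg (measurableSet_singleton 0)
        have hd : ∫ x in {x | g x = 0}, g x * Real.exp (0 * g x) ∂P = 0 := by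
          rw [setIntegral_congr_fun (g := fun _ ↦ (0 : ℝ)) hA
            (fun x hx ↦ by simp [show g x = 0 from hx]), integral_zero]
        obtain ⟨Q, hQ, hgQ, hmean, hent⟩ := exists_relEnt_le_neg_log_mgf P hg hA h0 (B := 0)
          (l := 0) (fun x hx ↦ by simp [show g x = 0 from hx]) hd.ge (by simp)
        refine (EReal.coe_ennreal_le_coe_ennreal_iff.2 ((hle Q hQ hgQ hmean).trans hent)).trans ?_
        have hp : 0 < P.real {x | g x = 0} := ENNReal.toReal_pos h0 (measure_ne_top _ _)
        rw [ProbabilityTheory.mgf_zero', measureReal_restrict_apply_univ,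
          EReal.coe_ennreal_ofReal, max_eq_left
            (neg_nonneg.2 (Real.log_nonpos hp.le measureReal_le_one)),
          ← ofReal_measureReal (measure_ne_top P _), ENNReal.log_ofReal_of_pos hp, EReal.coe_neg]
    · by_contra! hlt
      obtain ⟨c, hc1, hc2⟩ := EReal.lt_iff_exists_real_btwn.1 hlt
      have hc : 0 < c := by
        have : (0 : EReal) ≤ ⨆ (l : ℝ) (_ : 0 ≤ l),
            -ENNReal.log (∫⁻ x, ENNReal.ofReal (Real.exp (l * g x)) ∂P) :=
          le_iSup₂_of_le 0 le_rfl (by simp)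
        exact_mod_cast this.trans_lt hc1
      obtain ⟨l, hl, hint⟩ := exists_lintegral_exp_le P hg hpos hc fun Q h1 h2 h3 ↦ by
        have := hc2.trans_le (EReal.coe_ennreal_le_coe_ennreal_iff.2 (hle Q h1 h2 h3))
        rwa [← EReal.coe_ennreal_lt_coe_ennreal_iff, EReal.coe_ennreal_ofReal, max_eq_left hc.le]
      refine hc1.not_ge (le_iSup₂_of_le l hl ?_)
      have := ENNReal.log_le_log hint
      rw [ENNReal.log_ofReal_of_pos (Real.exp_pos _), Real.log_exp, EReal.coe_neg] at this
      exact EReal.le_neg_of_le_neg this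
  · refine iSup₂_le fun l hl ↦ ((le_max_right _ _).trans_eq EReal.coe_toENNReal_eq_max.symm).trans
      (EReal.coe_ennreal_le_coe_ennreal_iff.2 ?_)
    refine le_iInf fun Q ↦ le_iInf fun hQ ↦ le_iInf fun hgQ ↦ le_iInf fun hmean ↦ ?_
    have := EReal.toENNReal_le_toENNReal
      (neg_log_lintegral_exp_le_relEnt P Q hg hgQ hmean hl)
    rwa [EReal.toENNReal_coe] at this

/-- **Duality for the I-projection (inequality constraint).**
`inf { D(Q‖P) : ∫ f dQ ≥ α } = sup_{λ ≥ 0} (λ α - log ∫ e^{λ f} dP)`. -/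
theorem iProjection_duality_ge {X : Type*} [MeasurableSpace X]
    (P : Measure X) [IsProbabilityMeasure P] (f : X → ℝ) (hf : Measurable f) (α : ℝ) :
    ((⨅ (Q : Measure X) (_ : IsProbabilityMeasure Q) (_ : Integrable f Q)
        (_ : α ≤ ∫ x, f x ∂Q), relEnt Q P : ℝ≥0∞) : EReal)
      = ⨆ (l : ℝ) (_ : 0 ≤ l), ((l * α : ℝ) : EReal)
          - ENNReal.log (∫⁻ x, ENNReal.ofReal (Real.exp (l * f x)) ∂P) := by
  have hconstraint : ∀ Q : Measure X, IsProbabilityMeasure Q →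
      (⨅ (_ : Integrable f Q) (_ : α ≤ ∫ x, f x ∂Q), relEnt Q P)
        = ⨅ (_ : Integrable (fun x ↦ f x - α) Q) (_ : 0 ≤ ∫ x, (f x - α) ∂Q), relEnt Q P := by
    intro Q hQ
    have hiff : Integrable (fun x ↦ f x - α) Q ↔ Integrable f Q := by
      simp [sub_eq_add_neg]
    refine iInf_congr_Prop hiff.symm fun h ↦ iInf_congr_Prop ?_ fun _ ↦ rfl
    rw [integral_sub (hiff.1 h) (integrable_const _)]
    simp
  have hterm : ∀ l : ℝ, ((l * α : ℝ) : EReal)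
      - ENNReal.log (∫⁻ x, ENNReal.ofReal (Real.exp (l * f x)) ∂P)
      = -ENNReal.log (∫⁻ x, ENNReal.ofReal (Real.exp (l * (f x - α))) ∂P) := by
    intro l
    have hmul : ∀ x, ENNReal.ofReal (Real.exp (l * f x))
        = ENNReal.ofReal (Real.exp (l * α)) * ENNReal.ofReal (Real.exp (l * (f x - α))) := by
      intro x
      rw [← ENNReal.ofReal_mul (Real.exp_pos _).le, ← Real.exp_add]
      ring_nf
    simp_rw [hmul]
    rw [lintegral_const_mul _ (by fun_prop), ENNReal.log_mul_add,
      ENNReal.log_ofReal_of_pos (Real.exp_pos _), Real.log_exp]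
    generalize l * α = r
    induction ENNReal.log (∫⁻ x, ENNReal.ofReal (Real.exp (l * (f x - α))) ∂P) with
    | bot => simp
    | top => simp
    | coe y =>
      norm_cast
      ring
  simp_rw [hterm]
  rw [← iInf_relEnt_eq_iSup_neg_log P (hf.sub_const α)]
  exact congrArg _ (iInf_congr fun Q ↦ iInf_congr fun hQ ↦ hconstraint Q hQ)
end
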